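/- arXiv:1403.1352 — 2 statements merged into one kernel-verified Lean document; each statement's English description precedes it below -/
import Mathlib

section
/- There exists a constant c > 0 such that for every positive integer N the following holds: if L is a set of N² lines in ℝ³ such that every (2-dimensional affine) plane contains fewer than N of the lines of L, and P ⊆ ℝ³ is a finite set such that every line l ∈ L contains at least N points of P, then |P| ≥ c·N³. -/
/-- A line in `ℝ³`: a set of the form `{x + t • v : t ∈ ℝ}` with `v ≠ 0`. -/
def IsLine3 (l : Set (EuclideanSpace ℝ (Fin 3))) : Prop :=
  ∃ (x v : EuclideanSpace ℝ (Fin 3)), v ≠ 0 ∧ l = {y | ∃ t : ℝ, y = x + t • v}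

section

open MvPolynomial

/-- Points of three-dimensional Euclidean space. -/
local notation "E³" => EuclideanSpace ℝ (Fin 3)

/-- Real polynomials in three variables. -/
local notation "ℝ³[X]" => MvPolynomial (Fin 3) ℝ

theorem six_mul_sum_choose (n : ℕ) :
    6 * ∑ k ∈ Finset.range (n + 1), (3 + k - 1).choose k = (n + 1) * (n + 2) * (n + 3) := by
  induction n with
  | zero => simp
  | succ n ih =>
    have h : (3 + (n + 1) - 1).choose (n + 1) * 2 = (n + 2) * (n + 3) := by
      have : (3 + (n + 1) - 1) = n + 3 := by omega
      rw [this, Nat.choose_symm_of_eq_add (show n + 3 = (n + 1) + 2 by ring),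
        Nat.choose_two_right, Nat.div_mul_cancel (Nat.even_mul_pred_self _).two_dvd]
      simp
      ring
    rw [Finset.sum_range_succ, mul_add, ih]
    nlinarith

theorem finrank_restrictTotalDegree_three (n : ℕ) :
    6 * Module.finrank ℝ (restrictTotalDegree (Fin 3) ℝ n) = (n + 1) * (n + 2) * (n + 3) := by
  classical
  have h : Module.finrank ℝ (restrictTotalDegree (Fin 3) ℝ n) =
      ((Finset.range (n + 1)).biUnion
        fun k => (Finset.univ : Finset (Fin 3)).finsuppAntidiag k).card := by
    rw [restrictTotalDegree, Module.finrank_eq_nat_card_basis (basisRestrictSupport ℝ _),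
      ← Nat.card_eq_finsetCard]
    congr 2
    ext s
    simp [Finset.mem_finsuppAntidiag, Finsupp.sum_fintype]
  rw [h, Finset.card_biUnion]
  · simpa [Finset.card_finsuppAntidiag_nat_eq_choose] using six_mul_sum_choose n
  · intro i _ j _ hij
    rw [Function.onFun, Finset.disjoint_left]
    intro s hs hs'
    rw [Finset.mem_finsuppAntidiag'] at hs hs'
    exact hij (hs.1.symm.trans hs'.1)

/-- The polynomial `p` vanishes at every point of `l`. -/
def VanishesOn (p : ℝ³[X]) (l : Set E³) : Prop := ∀ y ∈ l, eval y.ofLp p = 0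

/-- Restriction of a polynomial to the line `t ↦ x + t • v`. -/
noncomputable def lineRestrict (x v : E³) : ℝ³[X] →ₐ[ℝ] Polynomial ℝ :=
  aeval fun i => Polynomial.C (x i) + Polynomial.C (v i) * Polynomial.X

theorem eval_lineRestrict (x v : E³) (p : ℝ³[X]) (t : ℝ) :
    (lineRestrict x v p).eval t = eval (x + t • v).ofLp p := by
  rw [lineRestrict, ← Polynomial.coe_aeval_eq_eval, ← AlgHom.coe_toRingHom,
    ← MvPolynomial.coe_aeval_eq_eval]
  have : ((Polynomial.aeval t : Polynomial ℝ →ₐ[ℝ] ℝ).comp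
      (aeval fun i => Polynomial.C (x i) + Polynomial.C (v i) * Polynomial.X)) =
        (aeval (x + t • v).ofLp : ℝ³[X] →ₐ[ℝ] ℝ) := by
    ext i
    simp
    ring
  exact congrArg (· p) (congrArg DFunLike.coe this)

theorem vanishesOn_line_iff (x v : E³) (p : ℝ³[X]) :
    VanishesOn p {y | ∃ t : ℝ, y = x + t • v} ↔ lineRestrict x v p = 0 := by
  constructor
  · intro h
    apply Polynomial.funext
    intro t
    rw [eval_lineRestrict, Polynomial.eval_zero]
    exact h _ ⟨t, rfl⟩
  · rintro h _ ⟨t, rfl⟩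
    rw [← eval_lineRestrict, h, Polynomial.eval_zero]

theorem natDegree_lineRestrict_le (x v : E³) (p : ℝ³[X]) :
    (lineRestrict x v p).natDegree ≤ p.totalDegree := by
  rw [lineRestrict, aeval_def, eval₂_eq]
  refine Polynomial.natDegree_sum_le_of_forall_le _ _ fun s hs => ?_
  refine Polynomial.natDegree_mul_le.trans ?_
  rw [show algebraMap ℝ (Polynomial ℝ) = Polynomial.C from rfl, Polynomial.natDegree_C, zero_add]
  refine (Polynomial.natDegree_prod_le _ _).trans ?_
  refine le_trans ?_ (le_totalDegree hs)
  refine Finset.sum_le_sum fun i _ => ?_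
  refine Polynomial.natDegree_pow_le.trans ?_
  refine (Nat.mul_le_mul_left _ ?_).trans_eq (mul_one _)
  compute_degree

/-- The affine polynomial `⟨n, y - x⟩` in the variable `y`. -/
noncomputable def planePoly (x n : E³) : ℝ³[X] := ∑ i, C (n i) * (X i - C (x i))

theorem eval_planePoly (x n y : E³) : eval y.ofLp (planePoly x n) = inner ℝ n (y - x) := by
  simp [planePoly, PiLp.inner_apply, mul_comm]

theorem totalDegree_planePoly_le (x n : E³) : (planePoly x n).totalDegree ≤ 1 := by
  refine totalDegree_finsetSum_le fun i _ => (totalDegree_mul _ _).trans ?_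
  rw [totalDegree_C, zero_add]
  exact (totalDegree_sub_C_le _ _).trans (totalDegree_X i).le

theorem lineRestrict_planePoly (x v : E³) :
    lineRestrict x v (planePoly x v) = Polynomial.C (inner ℝ v v) * Polynomial.X := by
  apply Polynomial.funext
  intro t
  rw [eval_lineRestrict, eval_planePoly]
  simp [inner_smul_right, mul_comm]

theorem IsLine3.eq_of_subset {l m : Set E³} (hl : IsLine3 l) (hm : IsLine3 m) (h : l ⊆ m) :
    l = m := by
  refine h.antisymm ?_
  obtain ⟨x, v, hv, rfl⟩ := hl
  obtain ⟨y, w, hw, rfl⟩ := hm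
  obtain ⟨a, ha⟩ := h ⟨0, rfl⟩
  obtain ⟨b, hb⟩ := h ⟨1, rfl⟩
  have hvw : v = (b - a) • w := by
    have : x + (1 : ℝ) • v - (x + (0 : ℝ) • v) = y + b • w - (y + a • w) := by rw [ha, hb]
    rw [sub_smul]
    simpa using this
  have hab : b - a ≠ 0 := by
    intro h0
    rw [h0, zero_smul] at hvw
    exact hv hvw
  rintro _ ⟨t, rfl⟩
  refine ⟨(t - a) / (b - a), ?_⟩
  rw [zero_smul, add_zero] at ha
  rw [ha, hvw, smul_smul, div_mul_cancel₀ _ hab, sub_smul]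
  abel

theorem exists_separating_poly {l m : Set E³} (hl : IsLine3 l) (hm : IsLine3 m) (h : l ≠ m) :
    ∃ p : ℝ³[X], p.totalDegree ≤ 1 ∧ VanishesOn p m ∧ ¬ VanishesOn p l := by
  obtain ⟨z, hzl, hzm⟩ := Set.not_subset.1 fun hlm => h (hl.eq_of_subset hm hlm)
  obtain ⟨y, w, hw, rfl⟩ := hm
  have hww : inner ℝ w w ≠ 0 := by simpa using hw
  set a : E³ := inner ℝ w w • (z - y) - inner ℝ w (z - y) • w with ha
  have haw : inner ℝ a w = 0 := by
    rw [ha, inner_sub_left, inner_smul_left, inner_smul_left, real_inner_comm w (z - y)]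
    simp [mul_comm]
  have ha0 : a ≠ 0 := by
    intro h0
    refine hzm ⟨inner ℝ w (z - y) / inner ℝ w w, ?_⟩
    rw [ha, sub_eq_zero] at h0
    rw [div_eq_inv_mul, mul_smul, ← h0, inv_smul_smul₀ hww]
    abel
  refine ⟨planePoly y a, totalDegree_planePoly_le _ _, ?_, ?_⟩
  · rintro _ ⟨t, rfl⟩
    rw [eval_planePoly, add_sub_cancel_left, inner_smul_right, haw, mul_zero]
  · intro hv
    have h1 := hv z hzl
    rw [eval_planePoly] at h1
    have h2 : inner ℝ a a = inner ℝ w w * inner ℝ a (z - y) := by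
      nth_rewrite 2 [ha]
      rw [inner_sub_right, inner_smul_right, inner_smul_right, haw, mul_zero, sub_zero]
    rw [h1, mul_zero, inner_self_eq_zero] at h2
    exact ha0 h2

theorem exists_isolating_poly {S : Finset (Set E³)} (hS : ∀ l ∈ S, IsLine3 l) {l : Set E³}
    (hl : l ∈ S) : ∃ p : ℝ³[X], p.totalDegree + 1 ≤ S.card ∧ ¬ VanishesOn p l ∧
      ∀ m ∈ S, m ≠ l → VanishesOn p m := by
  classical
  have h : ∀ m ∈ S.erase l, ∃ p : ℝ³[X], p.totalDegree ≤ 1 ∧ VanishesOn p m ∧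
      ¬ VanishesOn p l := fun m hm => exists_separating_poly (hS l hl)
    (hS m (Finset.mem_of_mem_erase hm)) (Finset.ne_of_mem_erase hm).symm
  choose! p hp using h
  refine ⟨∏ m ∈ S.erase l, p m, ?_, ?_, ?_⟩
  · rw [← Finset.card_erase_add_one hl]
    gcongr
    refine (totalDegree_finsetProd _ _).trans ?_
    simpa using Finset.sum_le_card_nsmul _ _ 1 fun m hm => (hp m hm).1
  · obtain ⟨x, v, hv, hxv⟩ := hS l hl
    rw [hxv, vanishesOn_line_iff, map_prod, Finset.prod_eq_zero_iff]
    rintro ⟨m, hm, h0⟩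
    rw [← hxv] at hm
    refine (hp m hm).2.2 ?_
    rwa [hxv, vanishesOn_line_iff]
  · intro m hm hml y hy
    rw [map_prod]
    exact Finset.prod_eq_zero (Finset.mem_erase.2 ⟨hml, hm⟩)
      ((hp m (Finset.mem_erase.2 ⟨hml, hm⟩)).2.1 y hy)

theorem totalDegree_aeval_le (p : Polynomial ℝ) (f : ℝ³[X]) :
    (Polynomial.aeval f p).totalDegree ≤ p.natDegree * f.totalDegree := by
  rw [Polynomial.aeval_eq_sum_range]
  refine totalDegree_finsetSum_le fun i hi => (totalDegree_smul_le _ _).trans ?_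
  refine (totalDegree_pow _ _).trans ?_
  gcongr
  exact Nat.lt_succ_iff.1 (Finset.mem_range.1 hi)

theorem hilbert_inequality {f g : ℝ³[X]} (hg : g ≠ 0) (hfg : IsRelPrime f g)
    {S : Finset (Set E³)} (hS : ∀ l ∈ S, IsLine3 l) (hSf : ∀ l ∈ S, VanishesOn f l)
    (hSg : ∀ l ∈ S, VanishesOn g l) (n : ℕ) :
    S.card * (f.totalDegree + g.totalDegree + n + 1) +
      Module.finrank ℝ (restrictTotalDegree (Fin 3) ℝ (S.card + g.totalDegree + n)) +
      Module.finrank ℝ (restrictTotalDegree (Fin 3) ℝ (S.card + f.totalDegree + n)) ≤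
    Module.finrank ℝ
        (restrictTotalDegree (Fin 3) ℝ (S.card + f.totalDegree + g.totalDegree + n)) +
      Module.finrank ℝ (restrictTotalDegree (Fin 3) ℝ (S.card + n)) := by
  classical
  have hparam : ∀ l : S, ∃ xv : E³ × E³, xv.2 ≠ 0 ∧ l.1 = {y | ∃ t : ℝ, y = xv.1 + t • xv.2} := by
    intro l
    obtain ⟨x, v, hv, h⟩ := hS l.1 l.2
    exact ⟨(x, v), hv, h⟩
  choose xv hv hxv using hparam
  choose q hqdeg hql hqm using fun l : S => exists_isolating_poly hS l.2
  set k := f.totalDegree + g.totalDegree + n + 1 with hk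
  let A : (S → Polynomial.degreeLT ℝ k) →ₗ[ℝ] ℝ³[X] :=
    ∑ l : S, (LinearMap.mulLeft ℝ (q l)) ∘ₗ
      (Polynomial.aeval (planePoly (xv l).1 (xv l).2)).toLinearMap ∘ₗ
      (Polynomial.degreeLT ℝ k).subtype ∘ₗ LinearMap.proj l
  let F := (LinearMap.mulLeft ℝ f) ∘ₗ
    (restrictTotalDegree (Fin 3) ℝ (S.card + g.totalDegree + n)).subtype
  let G := (LinearMap.mulLeft ℝ g) ∘ₗ
    (restrictTotalDegree (Fin 3) ℝ (S.card + f.totalDegree + n)).subtype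
  let T := A.coprod (F.coprod G)
  have hA : ∀ b, A b = ∑ l : S, q l *
      Polynomial.aeval (planePoly (xv l).1 (xv l).2) (b l : Polynomial ℝ) := by
    intro b
    simp [A]
  have hrange : LinearMap.range T ≤
      restrictTotalDegree (Fin 3) ℝ (S.card + f.totalDegree + g.totalDegree + n) := by
    rintro _ ⟨⟨b, a₁, a₂⟩, rfl⟩
    have h₁ := (mem_restrictTotalDegree (Fin 3) (R := ℝ) _ _).1 a₁.2
    have h₂ := (mem_restrictTotalDegree (Fin 3) (R := ℝ) _ _).1 a₂.2
    refine Submodule.add_mem _ ?_ (Submodule.add_mem _ ?_ ?_)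
    · change A b ∈ _
      rw [hA]
      refine Submodule.sum_mem _ fun l _ => ?_
      rw [mem_restrictTotalDegree]
      have h3 : (b l : Polynomial ℝ).natDegree < k := by
        rcases eq_or_ne (b l : Polynomial ℝ) 0 with h0 | h0
        · rw [h0, Polynomial.natDegree_zero]
          omega
        · exact (Polynomial.natDegree_lt_iff_degree_lt h0).2 (Polynomial.mem_degreeLT.1 (b l).2)
      have h4 := (totalDegree_aeval_le (b l) (planePoly (xv l).1 (xv l).2)).trans
        (Nat.mul_le_mul_left _ (totalDegree_planePoly_le _ _))
      have h5 := hqdeg l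
      refine (totalDegree_mul _ _).trans ?_
      omega
    · rw [mem_restrictTotalDegree]
      refine (totalDegree_mul _ _).trans ?_
      simp only [Submodule.subtype_apply, LinearMap.fst_apply, LinearMap.snd_apply]
      omega
    · rw [mem_restrictTotalDegree]
      refine (totalDegree_mul _ _).trans ?_
      simp only [Submodule.subtype_apply, LinearMap.snd_apply]
      omega
  have hker : Module.finrank ℝ (LinearMap.ker T) ≤
      Module.finrank ℝ (restrictTotalDegree (Fin 3) ℝ (S.card + n)) := by
    have hmem : ∀ x ∈ LinearMap.ker T, x.1 = 0 ∧
        ∃ c ∈ restrictTotalDegree (Fin 3) ℝ (S.card + n),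
          (x.2.1 : ℝ³[X]) = g * c ∧ (x.2.2 : ℝ³[X]) = - (f * c) := by
      rintro ⟨b, a₁, a₂⟩ hx
      have h0 : A b + (f * (a₁ : ℝ³[X]) + g * (a₂ : ℝ³[X])) = 0 := hx
      have hb : b = 0 := by
        funext l
        have h1 := congrArg (lineRestrict (xv l).1 (xv l).2) h0
        have hfl := hSf l l.2
        have hgl := hSg l l.2
        have hqll := hql l
        rw [hxv l, vanishesOn_line_iff] at hfl hgl hqll
        rw [map_add, map_add, map_mul, map_mul, hfl, hgl, zero_mul, zero_mul, add_zero, add_zero,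
          map_zero, hA, map_sum, Finset.sum_eq_single l, map_mul, mul_eq_zero,
          or_iff_right hqll, ← Polynomial.aeval_algHom_apply, lineRestrict_planePoly] at h1
        · have hvv : inner ℝ (xv l).2 (xv l).2 ≠ 0 := by simpa using hv l
          have h2 : Polynomial.natDegree (Polynomial.C (inner ℝ (xv l).2 (xv l).2) *
              Polynomial.X : Polynomial ℝ) = 1 := Polynomial.natDegree_C_mul_X _ hvv
          rw [← Polynomial.comp_eq_aeval, Polynomial.comp_eq_zero_iff] at h1
          rcases h1 with h1 | ⟨-, h1⟩
          · exact Subtype.ext h1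
          · rw [h1, Polynomial.natDegree_C] at h2
            omega
        · intro m _ hml
          have h2 := hqm m l l.2 (fun h => hml (Subtype.ext h.symm))
          rw [hxv l, vanishesOn_line_iff] at h2
          rw [map_mul, h2, zero_mul]
        · simp
      refine ⟨hb, ?_⟩
      rw [hb, map_zero, zero_add] at h0
      obtain ⟨c, hc⟩ : g ∣ a₁ := by
        refine hfg.symm.dvd_of_dvd_mul_left (y := f) ?_
        rw [eq_neg_of_add_eq_zero_left h0]
        exact (dvd_mul_right _ _).neg_right
      refine ⟨c, ?_, hc, ?_⟩
      · rw [mem_restrictTotalDegree]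
        by_cases hc0 : c = 0
        · simp [hc0]
        have h1 := (mem_restrictTotalDegree (Fin 3) (R := ℝ) _ _).1 a₁.2
        rw [hc, totalDegree_mul_of_isDomain hg hc0] at h1
        omega
      · refine mul_left_cancel₀ hg ?_
        rw [hc] at h0
        linear_combination h0
    let R : LinearMap.ker T →ₗ[ℝ] ℝ³[X] :=
      (Submodule.subtype _) ∘ₗ (LinearMap.fst ℝ _ _) ∘ₗ (LinearMap.snd ℝ _ _) ∘ₗ
        (LinearMap.ker T).subtype
    have hR : Function.Injective R := by
      rw [injective_iff_map_eq_zero]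
      rintro ⟨x, hx⟩ h0
      obtain ⟨h1, c, hc, h2, h3⟩ := hmem x hx
      have h4 : (x.2.1 : ℝ³[X]) = 0 := h0
      have hc0 : c = 0 := by
        rw [h4] at h2
        exact (mul_eq_zero.1 h2.symm).resolve_left hg
      ext1
      refine Prod.ext h1 (Prod.ext (Subtype.ext h4) (Subtype.ext ?_))
      rw [h3, hc0]
      simp
    have hRr : LinearMap.range R ≤ Submodule.map (LinearMap.mulLeft ℝ g)
        (restrictTotalDegree (Fin 3) ℝ (S.card + n)) := by
      rintro _ ⟨⟨x, hx⟩, rfl⟩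
      obtain ⟨h1, c, hc, h2, h3⟩ := hmem x hx
      exact ⟨c, hc, h2.symm⟩
    rw [← LinearMap.finrank_range_of_inj hR]
    exact (Submodule.finrank_mono hRr).trans (Submodule.finrank_map_le _ _)
  have hsum := T.finrank_range_add_finrank_ker
  have hr := Submodule.finrank_mono hrange
  have hdom : Module.finrank ℝ (S → Polynomial.degreeLT ℝ k) = S.card * k := by
    rw [Module.finrank_pi_fintype]
    simp [LinearEquiv.finrank_eq (Polynomial.degreeLTEquiv ℝ k)]
  rw [Module.finrank_prod, Module.finrank_prod, hdom] at hsum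
  omega

/-- A form of Bézout's theorem: two coprime polynomials vanish simultaneously on at most
`deg f * deg g` lines. -/
theorem card_common_lines_le {f g : ℝ³[X]} (hg : g ≠ 0) (hfg : IsRelPrime f g)
    {S : Finset (Set E³)} (hS : ∀ l ∈ S, IsLine3 l) (hSf : ∀ l ∈ S, VanishesOn f l)
    (hSg : ∀ l ∈ S, VanishesOn g l) : S.card ≤ f.totalDegree * g.totalDegree := by
  by_contra! hlt
  set n := f.totalDegree * g.totalDegree * (S.card + f.totalDegree + g.totalDegree + 1) with hn
  have h := hilbert_inequality hg hfg hS hSf hSg n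
  have h₁ := finrank_restrictTotalDegree_three (S.card + g.totalDegree + n)
  have h₂ := finrank_restrictTotalDegree_three (S.card + f.totalDegree + n)
  have h₃ := finrank_restrictTotalDegree_three (S.card + f.totalDegree + g.totalDegree + n)
  have h₄ := finrank_restrictTotalDegree_three (S.card + n)
  clear_value n
  generalize Module.finrank ℝ (restrictTotalDegree (Fin 3) ℝ (S.card + g.totalDegree + n)) = r₁
    at h h₁
  generalize Module.finrank ℝ (restrictTotalDegree (Fin 3) ℝ (S.card + f.totalDegree + n)) = r₂
    at h h₂
  generalize Module.finrank ℝ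
    (restrictTotalDegree (Fin 3) ℝ (S.card + f.totalDegree + g.totalDegree + n)) = r₃ at h h₃
  generalize Module.finrank ℝ (restrictTotalDegree (Fin 3) ℝ (S.card + n)) = r₄ at h h₄
  clear hSf hSg hfg hg hS
  generalize S.card = M at *
  generalize f.totalDegree = d at *
  generalize g.totalDegree = e at *
  have key : 6 * (M * (d + e + n + 1)) ≤ d * e * (6 * (M + n) + 3 * (d + e) + 12) := by
    zify at *
    linarith
  generalize hq : d * e = q at *
  zify at *
  nlinarith [mul_nonneg (sub_nonneg.2 (Int.add_one_le_iff.2 hlt)) (by positivity : (0 : ℤ) ≤ n + 1),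
    mul_nonneg (by positivity : (0 : ℤ) ≤ M) (by positivity : (0 : ℤ) ≤ d + e),
    mul_nonneg (by positivity : (0 : ℤ) ≤ q) (by positivity : (0 : ℤ) ≤ d + e)]

theorem derivative_lineRestrict (x v : E³) (p : ℝ³[X]) :
    Polynomial.derivative (lineRestrict x v p) =
      ∑ i, Polynomial.C (v i) * lineRestrict x v (pderiv i p) := by
  induction p using MvPolynomial.induction_on with
  | C a => simp [lineRestrict]
  | add p q hp hq => simp [hp, hq, mul_add, Finset.sum_add_distrib]
  | mul_X p j hp =>
    simp only [map_mul, Polynomial.derivative_mul, hp, Derivation.leibniz, pderiv_X, smul_eq_mul,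
      map_add, mul_add, Finset.sum_add_distrib, Finset.sum_mul]
    rw [add_comm]
    congr 1
    · rw [Finset.sum_eq_single j]
      · simp [lineRestrict]
        ring
      · intro i _ hij
        simp [Pi.single_eq_of_ne hij.symm]
      · simp
    · exact Finset.sum_congr rfl fun i _ => by ring

theorem pderiv_pderiv_comm (i j : Fin 3) (p : ℝ³[X]) :
    pderiv i (pderiv j p) = pderiv j (pderiv i p) := by
  ext m
  simp only [coeff_pderiv, Finsupp.add_apply]
  rw [add_right_comm m]
  rcases eq_or_ne i j with rfl | hij
  · rfl
  · rw [Finsupp.single_eq_of_ne hij, Finsupp.single_eq_of_ne hij.symm]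
    push_cast
    ring

theorem totalDegree_pderiv_lt {p : ℝ³[X]} {i : Fin 3} (h : pderiv i p ≠ 0) :
    (pderiv i p).totalDegree < p.totalDegree := by
  rw [totalDegree, Finset.sup_lt_iff]
  · intro m hm
    rw [mem_support_iff, coeff_pderiv] at hm
    have := le_totalDegree (mem_support_iff.2 (left_ne_zero_of_mul hm))
    rw [Finsupp.sum_add_index' (fun _ => rfl) (fun _ _ _ => rfl), Finsupp.sum_single_index rfl]
      at this
    omega
  · rw [bot_eq_zero, Nat.pos_iff_ne_zero]
    intro h0
    rw [totalDegree_eq_zero_iff_eq_C] at h0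
    rw [h0, pderiv_C] at h
    exact h rfl

theorem totalDegree_pderiv_le (p : ℝ³[X]) (i : Fin 3) :
    (pderiv i p).totalDegree ≤ p.totalDegree := by
  rcases eq_or_ne (pderiv i p) 0 with h | h
  · simp [h]
  · exact (totalDegree_pderiv_lt h).le

open Matrix in
/-- The second fundamental form of the level sets of `p` (up to scaling), evaluated at the tangent
vectors `a × ∇p` and `b × ∇p`. -/
noncomputable def flatPoly (p : ℝ³[X]) (a b : Fin 3 → ℝ) : ℝ³[X] :=
  ((fun i => C (a i)) ⨯₃ fun i => pderiv i p) ⬝ᵥ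
    (Matrix.of (fun i j => pderiv j (pderiv i p)) *ᵥ ((fun i => C (b i)) ⨯₃ fun i => pderiv i p))

open Matrix in
theorem map_flatPoly {A : Type*} [CommRing A] (φ : ℝ³[X] →+* A) (p : ℝ³[X]) (a b : Fin 3 → ℝ) :
    φ (flatPoly p a b) = ((fun i => φ (C (a i))) ⨯₃ fun i => φ (pderiv i p)) ⬝ᵥ
      (Matrix.of (fun i j => φ (pderiv j (pderiv i p))) *ᵥ
        ((fun i => φ (C (b i))) ⨯₃ fun i => φ (pderiv i p))) := by
  simp [flatPoly, dotProduct, mulVec, cross_apply, Fin.sum_univ_three]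

theorem totalDegree_flatPoly_le (p : ℝ³[X]) (a b : Fin 3 → ℝ) :
    (flatPoly p a b).totalDegree ≤ 3 * p.totalDegree := by
  have hc : ∀ (a : Fin 3 → ℝ) i,
      (crossProduct (fun i => C (a i)) (fun i => pderiv i p) i).totalDegree ≤ p.totalDegree := by
    intro a i
    have h : ∀ i j, (C (a i) * pderiv j p : ℝ³[X]).totalDegree ≤ p.totalDegree := by
      intro i j
      refine (totalDegree_mul _ _).trans ?_
      rw [totalDegree_C, zero_add]
      exact totalDegree_pderiv_le p j
    fin_cases i <;> simp only [cross_apply] <;>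
      exact (totalDegree_sub _ _).trans (max_le (h _ _) (h _ _))
  refine totalDegree_finsetSum_le fun i _ => (totalDegree_mul _ _).trans ?_
  have h2 : (Matrix.mulVec (Matrix.of (fun i j => pderiv j (pderiv i p)))
      (crossProduct (fun i => C (b i)) fun i => pderiv i p) i).totalDegree ≤
      2 * p.totalDegree := by
    refine totalDegree_finsetSum_le fun j _ => (totalDegree_mul _ _).trans ?_
    have h3 := (totalDegree_pderiv_le (pderiv i p) j).trans (totalDegree_pderiv_le p i)
    have h4 := hc b j
    simp only [Matrix.of_apply]
    omega
  have h1 := hc a i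
  omega

open Matrix in
theorem cross_eq_smul_of_orthogonal {n x y : Fin 3 → ℝ} (hx : x ⬝ᵥ n = 0) (hy : y ⬝ᵥ n = 0) :
    (n ⬝ᵥ n) • (x ⨯₃ y) = (n ⬝ᵥ (x ⨯₃ y)) • n := by
  simp only [dotProduct, Fin.sum_univ_three] at hx hy
  ext i
  fin_cases i <;>
    simp [dotProduct, cross_apply, Fin.sum_univ_three]
  · linear_combination (x 1 * n 2 - x 2 * n 1) * hy - (y 1 * n 2 - y 2 * n 1) * hx
  · linear_combination (x 2 * n 0 - x 0 * n 2) * hy - (y 2 * n 0 - y 0 * n 2) * hx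
  · linear_combination (x 0 * n 1 - x 1 * n 0) * hy - (y 0 * n 1 - y 1 * n 0) * hx

open Matrix in
/-- A quadratic form vanishing in three directions of a plane vanishes on that plane. -/
theorem bilin_eq_zero_of_three_directions (Q : LinearMap.BilinForm ℝ (Fin 3 → ℝ))
    (hQ : ∀ x y, Q x y = Q y x) {n v₁ v₂ v₃ : Fin 3 → ℝ} (hn : n ≠ 0) (h₁ : v₁ ⬝ᵥ n = 0)
    (h₂ : v₂ ⬝ᵥ n = 0) (h₃ : v₃ ⬝ᵥ n = 0) (h₁₂ : v₁ ⨯₃ v₂ ≠ 0) (h₃₂ : v₃ ⨯₃ v₂ ≠ 0)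
    (h₁₃ : v₁ ⨯₃ v₃ ≠ 0) (hQ₁ : Q v₁ v₁ = 0) (hQ₂ : Q v₂ v₂ = 0) (hQ₃ : Q v₃ v₃ = 0)
    {x y : Fin 3 → ℝ} (hx : x ⬝ᵥ n = 0) (hy : y ⬝ᵥ n = 0) : Q x y = 0 := by
  have hnn : n ⬝ᵥ n ≠ 0 := by rwa [Ne, dotProduct_self_eq_zero]
  have hne : ∀ {x y : Fin 3 → ℝ}, x ⬝ᵥ n = 0 → y ⬝ᵥ n = 0 → x ⨯₃ y ≠ 0 → n ⬝ᵥ (x ⨯₃ y) ≠ 0 := by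
    intro x y hx hy hxy h0
    have := cross_eq_smul_of_orthogonal hx hy
    rw [h0, zero_smul, smul_eq_zero] at this
    exact this.elim hnn hxy
  have hspan : ∀ {u : Fin 3 → ℝ}, u ⬝ᵥ n = 0 →
      (n ⬝ᵥ (v₁ ⨯₃ v₂)) • u = (n ⬝ᵥ (u ⨯₃ v₂)) • v₁ + (n ⬝ᵥ (v₁ ⨯₃ u)) • v₂ := by
    intro u hu
    simp only [dotProduct, Fin.sum_univ_three] at hu h₁ h₂
    ext i
    fin_cases i <;>
      simp [dotProduct, cross_apply, Fin.sum_univ_three]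
    · linear_combination (v₁ 1 * v₂ 2 - v₁ 2 * v₂ 1) * hu - (u 1 * v₂ 2 - u 2 * v₂ 1) * h₁ +
        (u 1 * v₁ 2 - u 2 * v₁ 1) * h₂
    · linear_combination (v₁ 2 * v₂ 0 - v₁ 0 * v₂ 2) * hu - (u 2 * v₂ 0 - u 0 * v₂ 2) * h₁ +
        (u 2 * v₁ 0 - u 0 * v₁ 2) * h₂
    · linear_combination (v₁ 0 * v₂ 1 - v₁ 1 * v₂ 0) * hu - (u 0 * v₂ 1 - u 1 * v₂ 0) * h₁ +
        (u 0 * v₁ 1 - u 1 * v₁ 0) * h₂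
  have hQ₁₂ : Q v₁ v₂ = 0 := by
    have h := congrArg (fun w => Q w w) (hspan h₃)
    simp only [map_smul, map_add, LinearMap.smul_apply, LinearMap.add_apply, hQ₁, hQ₂, hQ₃,
      hQ v₂ v₁, smul_eq_mul] at h
    have h4 : (n ⬝ᵥ (v₃ ⨯₃ v₂)) * (n ⬝ᵥ (v₁ ⨯₃ v₃)) * Q v₁ v₂ = 0 := by linear_combination -h / 2
    exact (mul_eq_zero.1 h4).resolve_left (mul_ne_zero (hne h₃ h₂ h₃₂) (hne h₁ h₃ h₁₃))
  have h : Q ((n ⬝ᵥ (v₁ ⨯₃ v₂)) • x) ((n ⬝ᵥ (v₁ ⨯₃ v₂)) • y) = 0 := by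
    rw [hspan hx, hspan hy]
    simp [hQ₁, hQ₂, hQ₁₂, hQ v₂ v₁]
  have h0 := hne h₁ h₂ h₁₂
  simpa [h0] using h

theorem IsLine3.exists_direction {l : Set E³} (hl : IsLine3 l) {y : E³} (hy : y ∈ l) :
    ∃ v : E³, v ≠ 0 ∧ l = {z | ∃ t : ℝ, z = y + t • v} := by
  obtain ⟨x, v, hv, rfl⟩ := hl
  obtain ⟨s, rfl⟩ := hy
  refine ⟨v, hv, ?_⟩
  ext z
  constructor
  · rintro ⟨t, rfl⟩
    exact ⟨t - s, by rw [add_assoc, ← add_smul]; simp⟩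
  · rintro ⟨t, rfl⟩
    exact ⟨s + t, by rw [add_assoc, ← add_smul]⟩

open Matrix in
theorem cross_ne_zero_of_lines_ne {y v w : E³} (hv : v ≠ 0) (hw : w ≠ 0)
    (h : {z | ∃ t : ℝ, z = y + t • v} ≠ {z | ∃ t : ℝ, z = y + t • w}) :
    v.ofLp ⨯₃ w.ofLp ≠ 0 := by
  rw [crossProduct_ne_zero_iff_linearIndependent, LinearIndependent.pair_iff' (by simpa using hv)]
  intro a ha
  refine h (IsLine3.eq_of_subset ⟨y, v, hv, rfl⟩ ⟨y, w, hw, rfl⟩ ?_)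
  have hwv : w = a • v := by
    ext i
    simpa using (congrFun ha i).symm
  have ha0 : a ≠ 0 := by
    rintro rfl
    exact hw (by simpa using hwv)
  rintro _ ⟨t, rfl⟩
  exact ⟨t / a, by rw [hwv, smul_smul, div_mul_cancel₀ _ ha0]⟩

open Matrix in
theorem dotProduct_grad_eq_zero {p : ℝ³[X]} {y v : E³} (h : lineRestrict y v p = 0) :
    v.ofLp ⬝ᵥ (fun i => eval y.ofLp (pderiv i p)) = 0 := by
  have h1 := congrArg (Polynomial.eval 0) (derivative_lineRestrict y v p)
  rw [h] at h1
  simpa [Polynomial.eval_finsetSum, eval_lineRestrict, dotProduct] using h1.symm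

open Matrix in
theorem hess_eq_zero {p : ℝ³[X]} {y v : E³} (h : lineRestrict y v p = 0) :
    v.ofLp ⬝ᵥ (Matrix.of (fun i j => eval y.ofLp (pderiv j (pderiv i p))) *ᵥ v.ofLp) = 0 := by
  have h1 := congrArg (fun q => Polynomial.eval 0 (Polynomial.derivative q))
    (derivative_lineRestrict y v p)
  rw [h] at h1
  simpa [Polynomial.eval_finsetSum, eval_lineRestrict, dotProduct, mulVec,
    derivative_lineRestrict, mul_comm] using h1.symm

open Matrix in
/-- A point of the zero set of `p` through which three lines of the zero set pass is either singular
or flat. -/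
theorem eval_flatPoly_eq_zero {p : ℝ³[X]} {y : E³} {l₁ l₂ l₃ : Set E³} (hl₁ : IsLine3 l₁)
    (hl₂ : IsLine3 l₂) (hl₃ : IsLine3 l₃) (hy₁ : y ∈ l₁) (hy₂ : y ∈ l₂) (hy₃ : y ∈ l₃)
    (hp₁ : VanishesOn p l₁) (hp₂ : VanishesOn p l₂) (hp₃ : VanishesOn p l₃)
    (h₁₂ : l₁ ≠ l₂) (h₁₃ : l₁ ≠ l₃) (h₂₃ : l₂ ≠ l₃) (a b : Fin 3 → ℝ) :
    eval y.ofLp (flatPoly p a b) = 0 := by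
  obtain ⟨v₁, hv₁, rfl⟩ := hl₁.exists_direction hy₁
  obtain ⟨v₂, hv₂, rfl⟩ := hl₂.exists_direction hy₂
  obtain ⟨v₃, hv₃, rfl⟩ := hl₃.exists_direction hy₃
  rw [vanishesOn_line_iff] at hp₁ hp₂ hp₃
  rw [map_flatPoly]
  simp only [eval_C]
  set n : Fin 3 → ℝ := fun i => eval y.ofLp (pderiv i p) with hn
  set H : Matrix (Fin 3) (Fin 3) ℝ :=
    Matrix.of (fun i j => eval y.ofLp (pderiv j (pderiv i p))) with hH
  by_cases hn0 : n = 0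
  · simp [hn0]
  have hQ : ∀ u w, Matrix.toBilin' H u w = u ⬝ᵥ (H *ᵥ w) := fun u w => Matrix.toBilin'_apply' H u w
  have hsymm : ∀ u w, Matrix.toBilin' H u w = Matrix.toBilin' H w u := by
    intro u w
    have hHT : Hᵀ = H := by
      ext i j
      simp [hH, pderiv_pderiv_comm i j]
    rw [hQ, hQ, Matrix.dotProduct_mulVec, dotProduct_comm, ← Matrix.mulVec_transpose, hHT]
  rw [← hQ]
  refine bilin_eq_zero_of_three_directions _ hsymm hn0 (dotProduct_grad_eq_zero hp₁)
    (dotProduct_grad_eq_zero hp₂) (dotProduct_grad_eq_zero hp₃)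
    (cross_ne_zero_of_lines_ne hv₁ hv₂ h₁₂) (cross_ne_zero_of_lines_ne hv₃ hv₂ h₂₃.symm)
    (cross_ne_zero_of_lines_ne hv₁ hv₃ h₁₃) ?_ ?_ ?_ ?_ ?_
  · rw [hQ, hess_eq_zero hp₁]
  · rw [hQ, hess_eq_zero hp₂]
  · rw [hQ, hess_eq_zero hp₃]
  · rw [dotProduct_comm, dot_cross_self]
  · rw [dotProduct_comm, dot_cross_self]

theorem X_pow_succ_dvd_of_derivative {f : Polynomial ℝ} {k : ℕ} (h0 : f.eval 0 = 0)
    (h : Polynomial.X ^ k ∣ Polynomial.derivative f) : Polynomial.X ^ (k + 1) ∣ f := by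
  rw [Polynomial.X_pow_dvd_iff] at h ⊢
  rintro (_ | d) hd
  · rwa [Polynomial.coeff_zero_eq_eval_zero]
  · have := h d (by omega)
    rw [Polynomial.coeff_derivative] at this
    exact (mul_eq_zero.1 this).resolve_right (by positivity)

theorem dvd_of_dvd_mul_of_eval_ne_zero {f g : Polynomial ℝ} {k : ℕ} (hf : f.eval 0 ≠ 0)
    (h : Polynomial.X ^ k ∣ f * g) : Polynomial.X ^ k ∣ g := by
  refine (IsCoprime.pow_left ?_).dvd_of_dvd_mul_left h
  rw [Polynomial.prime_X.irreducible.coprime_iff_not_dvd, Polynomial.X_dvd_iff,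
    Polynomial.coeff_zero_eq_eval_zero]
  exact hf

open Matrix in
theorem cross_proportional {A : Type*} [CommRing A] {n c : Fin 3 → A} (h : n ⨯₃ c = 0) :
    (c ⬝ᵥ c) • n = (n ⬝ᵥ c) • c := by
  have h0 := congrFun h 0
  have h1 := congrFun h 1
  have h2 := congrFun h 2
  simp [cross_apply] at h0 h1 h2
  ext i
  fin_cases i <;>
    simp [dotProduct, Fin.sum_univ_three]
  · linear_combination c 2 * -h1 + c 1 * h2
  · linear_combination c 2 * h0 - c 0 * h2
  · linear_combination c 0 * h1 - c 1 * h0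

open Matrix in
/-- The pointwise computation behind `lineRestrict_eq_zero_of_flat`, in a ring where `n` is
parallel to the constant vector `c`. -/
theorem mulVec_cross_eq_zero {A : Type*} [CommRing A] {n c v : Fin 3 → A}
    {H : Matrix (Fin 3) (Fin 3) A} {r : A} (hnc : n ⨯₃ c = 0) (hr : r * (c ⬝ᵥ c) = 1)
    (hσ : IsUnit (n ⬝ᵥ c)) (hvc : v ⬝ᵥ c = 0)
    (hflat : ∀ i, (Pi.single i 1 ⨯₃ n) ⬝ᵥ (H *ᵥ ((r • (c ⨯₃ v)) ⨯₃ n)) = 0) :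
    (H *ᵥ v) ⨯₃ c = 0 := by
  have hn := cross_proportional hnc
  have hv : (r • (c ⨯₃ v)) ⨯₃ c = v := by
    simp only [dotProduct, Fin.sum_univ_three] at hvc hr
    ext i
    fin_cases i <;> simp [cross_apply]
    · linear_combination v 0 * hr - r * c 0 * hvc
    · linear_combination v 1 * hr - r * c 1 * hvc
    · linear_combination v 2 * hr - r * c 2 * hvc
  have key : ∀ i, (Pi.single i 1 ⨯₃ c) ⬝ᵥ (H *ᵥ v) = 0 := by
    intro i
    have h1 : ∀ a : Fin 3 → A, (c ⬝ᵥ c) • (a ⨯₃ n) = (n ⬝ᵥ c) • (a ⨯₃ c) := by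
      intro a
      rw [← map_smul, hn, map_smul]
    have h2 : ((c ⬝ᵥ c) • (Pi.single i 1 ⨯₃ n)) ⬝ᵥ
        (H *ᵥ ((c ⬝ᵥ c) • ((r • (c ⨯₃ v)) ⨯₃ n))) = 0 := by
      rw [mulVec_smul, smul_dotProduct, dotProduct_smul, hflat, smul_zero, smul_zero]
    rw [h1, h1, mulVec_smul, smul_dotProduct, dotProduct_smul, hv, smul_smul, smul_eq_mul,
      (hσ.mul hσ).mul_right_eq_zero] at h2
    exact h2
  have h0 := key 0
  have h1 := key 1
  have h2 := key 2
  generalize H *ᵥ v = w at *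
  simp [cross_apply, dotProduct, Fin.sum_univ_three] at h0 h1 h2
  ext i
  fin_cases i <;> simp [cross_apply]
  · linear_combination -h0
  · linear_combination -h1
  · linear_combination -h2

open Matrix in
/-- If `q` divides all flatness polynomials of `p = q * s`, then near a regular point `x` of `p` the
zero set of `q` contains the tangent plane: `q` and the component of `∇p` tangential to that plane
satisfy a homogeneous linear system of differential equations along lines in the plane. -/
theorem lineRestrict_eq_zero_of_flat {p q s : ℝ³[X]} {x v : E³} (hp : p = q * s)
    (hflat : ∀ a b, q ∣ flatPoly p a b) (hq : eval x.ofLp q = 0)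
    (hgrad : (fun i => eval x.ofLp (pderiv i p)) ≠ 0)
    (hv : v.ofLp ⬝ᵥ (fun i => eval x.ofLp (pderiv i p)) = 0) : lineRestrict x v q = 0 := by
  set c : Fin 3 → ℝ := fun i => eval x.ofLp (pderiv i p) with hc
  have hcc : c ⬝ᵥ c ≠ 0 := by rwa [Ne, dotProduct_self_eq_zero]
  set ρ : ℝ³[X] →ₐ[ℝ] Polynomial ℝ := lineRestrict x v with hρ
  have hρ0 : ∀ f, (ρ f).eval 0 = eval x.ofLp f := fun f => by
    rw [hρ, eval_lineRestrict, zero_smul, add_zero]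
  set m : Fin 3 → Polynomial ℝ := (fun i => ρ (pderiv i p)) ⨯₃ fun i => Polynomial.C (c i) with hm
  have hm0 : ∀ i, (m i).eval 0 = 0 := by
    intro i
    fin_cases i <;> simp [hm, cross_apply, hρ0, hc] <;> ring
  have hs0 : (ρ s).eval 0 ≠ 0 := by
    intro h
    rw [hρ0] at h
    refine hgrad (funext fun i => ?_)
    rw [hc, hp]
    simp [hq, h]
  have hall : ∀ k, Polynomial.X ^ k ∣ ρ q ∧ ∀ i, Polynomial.X ^ k ∣ m i := by
    intro k
    induction k with
    | zero => simp
    | succ k ih =>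
      obtain ⟨hqk, hmk⟩ := ih
      let I : Ideal (Polynomial ℝ) := Ideal.span {Polynomial.X ^ k}
      let φ : Polynomial ℝ →+* Polynomial ℝ ⧸ I := Ideal.Quotient.mk I
      have hφ : ∀ f, φ f = 0 ↔ Polynomial.X ^ k ∣ f := fun f => by
        rw [Ideal.Quotient.eq_zero_iff_mem, Ideal.mem_span_singleton]
      set n' : Fin 3 → Polynomial ℝ ⧸ I := fun i => φ (ρ (pderiv i p)) with hn'
      set c' : Fin 3 → Polynomial ℝ ⧸ I := fun i => φ (Polynomial.C (c i)) with hc'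
      set v' : Fin 3 → Polynomial ℝ ⧸ I := fun i => φ (Polynomial.C (v i)) with hv'
      set H : Matrix (Fin 3) (Fin 3) (Polynomial ℝ ⧸ I) :=
        Matrix.of (fun i j => φ (ρ (pderiv j (pderiv i p)))) with hH
      have hρC : ∀ a : ℝ, ρ (C a) = Polynomial.C a := fun a => by simp [hρ, lineRestrict]
      have hnc : n' ⨯₃ c' = 0 := by
        ext i
        rw [Pi.zero_apply, ← (hφ (m i)).2 (hmk i)]
        fin_cases i <;> simp [hm, cross_apply, hn', hc']
      have hr : φ (Polynomial.C (c ⬝ᵥ c)⁻¹) * (c' ⬝ᵥ c') = 1 := by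
        have h1 : c' ⬝ᵥ c' = φ (Polynomial.C (c ⬝ᵥ c)) := by
          simp [hc', dotProduct, Fin.sum_univ_three]
        rw [h1, ← map_mul, ← map_mul, inv_mul_cancel₀ hcc, map_one, map_one]
      have hσ : IsUnit (n' ⬝ᵥ c') := by
        have h1 : n' ⬝ᵥ c' = φ (∑ i, ρ (pderiv i p) * Polynomial.C (c i)) := by
          simp [hn', hc', dotProduct]
        have h2 : IsCoprime (Polynomial.X ^ k) (∑ i, ρ (pderiv i p) * Polynomial.C (c i)) := by
          refine IsCoprime.pow_left ?_
          rw [Polynomial.prime_X.irreducible.coprime_iff_not_dvd, Polynomial.X_dvd_iff,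
            Polynomial.coeff_zero_eq_eval_zero]
          simp only [Polynomial.eval_finsetSum, Polynomial.eval_mul, Polynomial.eval_C, hρ0]
          exact hcc
        obtain ⟨u, w, huw⟩ := h2
        rw [h1]
        refine IsUnit.of_mul_eq_one (φ w) ?_
        rw [← map_mul, ← sub_eq_zero, ← map_one φ, ← map_sub, hφ, ← huw]
        exact ⟨-u, by ring⟩
      have hvc : v' ⬝ᵥ c' = 0 := by
        have h1 : v' ⬝ᵥ c' = φ (Polynomial.C (v.ofLp ⬝ᵥ c)) := by
          simp [hv', hc', dotProduct, Fin.sum_univ_three]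
        rw [h1, hv, map_zero, map_zero]
      have hmain : (H *ᵥ v') ⨯₃ c' = 0 := by
        refine mulVec_cross_eq_zero hnc hr hσ hvc fun i => ?_
        have h1 : φ (ρ (flatPoly p (Pi.single i 1) ((c ⬝ᵥ c)⁻¹ • (c ⨯₃ v.ofLp)))) = 0 :=
          (hφ _).2 (hqk.trans (map_dvd ρ (hflat _ _)))
        have h2 := map_flatPoly (φ.comp (ρ : ℝ³[X] →+* Polynomial ℝ)) p (Pi.single i 1)
          ((c ⬝ᵥ c)⁻¹ • (c ⨯₃ v.ofLp))
        have h3 : (fun j => φ (Polynomial.C ((Pi.single i 1 : Fin 3 → ℝ) j))) =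
            (Pi.single i 1 : Fin 3 → Polynomial ℝ ⧸ I) := by
          ext j
          rcases eq_or_ne j i with rfl | hji
          · simp
          · simp [hji]
        have h4 : (fun j => φ (Polynomial.C (((c ⬝ᵥ c)⁻¹ • (c ⨯₃ v.ofLp)) j))) =
            φ (Polynomial.C (c ⬝ᵥ c)⁻¹) • (c' ⨯₃ v') := by
          ext j
          fin_cases j <;> simp [cross_apply, hc', hv']
        simp only [RingHom.comp_apply, RingHom.coe_coe, h1, hρC, h3, h4] at h2
        exact h2.symm
      constructor
      · refine X_pow_succ_dvd_of_derivative (by rw [hρ0, hq])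
          (dvd_of_dvd_mul_of_eval_ne_zero hs0 ?_)
        have h1 : ρ s * Polynomial.derivative (ρ q) =
            ∑ i, Polynomial.C (v i) * ρ (pderiv i p) -
              ρ q * ∑ i, Polynomial.C (v i) * ρ (pderiv i s) := by
          rw [hρ, derivative_lineRestrict, hp]
          simp [Fin.sum_univ_three, Derivation.leibniz]
          ring
        rw [h1]
        refine dvd_sub ?_ (hqk.mul_right _)
        rw [← hφ]
        have h2 := congrArg (fun w => φ (Polynomial.C (c ⬝ᵥ c)⁻¹) * (v' ⬝ᵥ w))
          (cross_proportional hnc)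
        simp only [dotProduct_smul, smul_eq_mul, hvc, mul_zero, ← mul_assoc, hr, one_mul] at h2
        simpa [dotProduct, hv', hn'] using h2
      · intro i
        refine X_pow_succ_dvd_of_derivative (hm0 i) ?_
        rw [← hφ]
        have h1 := congrFun hmain i
        rw [Pi.zero_apply] at h1
        rw [← h1]
        fin_cases i <;>
          simp [hm, cross_apply, hρ, derivative_lineRestrict, mulVec, dotProduct, hH, hc', hv',
            Fin.sum_univ_three] <;> ring
  by_contra h0
  have h1 := Polynomial.natDegree_le_of_dvd (hall ((ρ q).natDegree + 1)).1 h0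
  rw [Polynomial.natDegree_X_pow] at h1
  omega

/-- A polynomial vanishing on a plane is divisible by the equation of the plane. -/
theorem planePoly_dvd {q : ℝ³[X]} {x n : E³} (hn : n ≠ 0)
    (hq : ∀ y : E³, inner ℝ n (y - x) = 0 → eval y.ofLp q = 0) : planePoly x n ∣ q := by
  have hnn : inner ℝ n n ≠ 0 := by simpa using hn
  let f : Fin 3 → ℝ³[X] := fun i => X i - C (n i / inner ℝ n n) * planePoly x n
  have h0 : aeval f q = 0 := by
    refine MvPolynomial.funext fun y => ?_
    rw [map_zero]
    have h1 : eval y (aeval f q) = eval (fun i => eval y (f i)) q := by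
      have := MvPolynomial.comp_aeval_apply f (aeval y : ℝ³[X] →ₐ[ℝ] ℝ) q
      simpa only [MvPolynomial.aeval_eq_eval, RingHom.coe_coe] using this
    rw [h1]
    have h2 : (fun i => eval y (f i)) = (WithLp.toLp 2 y -
        (inner ℝ n (WithLp.toLp 2 y - x) / inner ℝ n n) • n : E³).ofLp := by
      ext i
      have := eval_planePoly x n (WithLp.toLp 2 y)
      simp only at this
      simp [f, this]
      ring
    rw [h2]
    refine hq _ ?_
    rw [sub_right_comm, inner_sub_right, inner_smul_right, div_mul_cancel₀ _ hnn, sub_self]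
  have h1 : (Ideal.Quotient.mkₐ ℝ (Ideal.span {planePoly x n})).comp (aeval f) =
      Ideal.Quotient.mkₐ ℝ (Ideal.span {planePoly x n}) := by
    ext i
    simp only [AlgHom.comp_apply, aeval_X, f, Ideal.Quotient.mkₐ_eq_mk]
    rw [Ideal.Quotient.eq, Ideal.mem_span_singleton]
    exact ⟨-C (n i / inner ℝ n n), by ring⟩
  have h2 := congrArg (fun g => g q) h1
  simp only [AlgHom.comp_apply, h0, map_zero] at h2
  rw [Ideal.Quotient.mkₐ_eq_mk, eq_comm, Ideal.Quotient.eq_zero_iff_mem,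
    Ideal.mem_span_singleton] at h2
  exact h2

open Matrix in
/-- If `q` is an irreducible factor of `p` dividing all flatness polynomials of `p` and passing
through a regular point of `p`, then the zero lines of `q` lie in a plane. -/
theorem exists_plane_of_flat {p q s : ℝ³[X]} (hirr : Irreducible q) {x : E³} (hp : p = q * s)
    (hflat : ∀ a b, q ∣ flatPoly p a b) (hq : eval x.ofLp q = 0)
    (hgrad : (fun i => eval x.ofLp (pderiv i p)) ≠ 0) :
    ∃ W : AffineSubspace ℝ E³, Module.finrank ℝ W.direction = 2 ∧
      ∀ l, VanishesOn q l → l ⊆ (W : Set E³) := by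
  set n : E³ := WithLp.toLp 2 (fun i => eval x.ofLp (pderiv i p)) with hn
  have hn0 : n ≠ 0 := fun h => hgrad (by simpa [hn] using congrArg WithLp.ofLp h)
  have hvan : ∀ y : E³, inner ℝ n (y - x) = 0 → eval y.ofLp q = 0 := by
    intro y hy
    have h1 : (y - x).ofLp ⬝ᵥ (fun i => eval x.ofLp (pderiv i p)) = 0 := by
      rw [EuclideanSpace.inner_eq_star_dotProduct] at hy
      simpa [hn] using hy
    have h2 := lineRestrict_eq_zero_of_flat hp hflat hq hgrad h1
    have h3 := eval_lineRestrict x (y - x) q 1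
    rw [h2, one_smul, add_sub_cancel] at h3
    simpa using h3.symm
  obtain ⟨r, hr⟩ := planePoly_dvd hn0 hvan
  have hunit : ¬ IsUnit (planePoly x n) := by
    intro h
    have h1 := h.map (eval x.ofLp)
    rw [eval_planePoly, sub_self, inner_zero_right] at h1
    exact not_isUnit_zero h1
  have hrunit : IsUnit r := (hirr.isUnit_or_isUnit hr).resolve_left hunit
  have hr0 : ∀ y : E³, eval y.ofLp r ≠ 0 := fun y => (hrunit.map (eval y.ofLp)).ne_zero
  refine ⟨AffineSubspace.mk' x (ℝ ∙ n)ᗮ, ?_, ?_⟩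
  · have : Fact (Module.finrank ℝ E³ = 2 + 1) := ⟨by simp⟩
    rw [AffineSubspace.direction_mk']
    exact Submodule.finrank_orthogonal_span_singleton hn0
  · intro l hl y hy
    have h1 := hl y hy
    rw [hr, map_mul, mul_eq_zero, or_iff_left (hr0 y), eval_planePoly] at h1
    rw [SetLike.mem_coe, AffineSubspace.mem_mk', vsub_eq_sub,
      Submodule.mem_orthogonal_singleton_iff_inner_right]
    exact h1

theorem vanishesOn_of_card_lt {p : ℝ³[X]} {l : Set E³} (hl : IsLine3 l) {T : Finset E³}
    (hTl : ∀ y ∈ T, y ∈ l) (hT : ∀ y ∈ T, eval y.ofLp p = 0) (hcard : p.totalDegree < T.card) :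
    VanishesOn p l := by
  classical
  obtain ⟨x, v, hv, rfl⟩ := hl
  rw [vanishesOn_line_iff]
  choose! t ht using hTl
  have hinj : Set.InjOn t T := by
    intro y hy z hz hyz
    rw [ht y hy, ht z hz, hyz]
  refine Polynomial.eq_zero_of_natDegree_lt_card_of_eval_eq_zero' _ (T.image t) ?_ ?_
  · intro r hr
    obtain ⟨y, hy, rfl⟩ := Finset.mem_image.1 hr
    rw [eval_lineRestrict, ← ht y hy, hT y hy]
  · rw [Finset.card_image_of_injOn hinj]
    exact (natDegree_lineRestrict_le _ _ _).trans_lt hcard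

theorem VanishesOn.mul_iff {p q : ℝ³[X]} {l : Set E³} (hl : IsLine3 l) :
    VanishesOn (p * q) l ↔ VanishesOn p l ∨ VanishesOn q l := by
  obtain ⟨x, v, hv, rfl⟩ := hl
  rw [vanishesOn_line_iff, vanishesOn_line_iff, vanishesOn_line_iff, map_mul, mul_eq_zero]

theorem totalDegree_ne_zero_of_irreducible {q : ℝ³[X]} (hq : Irreducible q) :
    q.totalDegree ≠ 0 := by
  intro h
  rw [totalDegree_eq_zero_iff_eq_C] at h
  refine hq.not_isUnit ?_
  have h0 : q.coeff 0 ≠ 0 := by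
    intro h0
    rw [h0, map_zero] at h
    exact hq.ne_zero h
  rw [h]
  exact (isUnit_iff_ne_zero.2 h0).map C

open Classical in
/-- Contribution of a single irreducible factor to the number of lines on which all flatness
polynomials vanish. -/
theorem card_lines_irreducible_le {p q : ℝ³[X]} (hirr : Irreducible q) (hqp : q ∣ p)
    (hsq : ¬ q * q ∣ p) {G : Finset (Set E³)} (hG : ∀ l ∈ G, IsLine3 l)
    (hflat : ∀ l ∈ G, ∀ a b, VanishesOn (flatPoly p a b) l) {N : ℕ}
    (hplane : ∀ W : AffineSubspace ℝ E³, Module.finrank ℝ W.direction = 2 →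
      {l ∈ G | l ⊆ (W : Set E³)}.card ≤ N) :
    {l ∈ G | VanishesOn q l}.card ≤ q.totalDegree * (4 * p.totalDegree + N) := by
  have hdeg := Nat.one_le_iff_ne_zero.2 (totalDegree_ne_zero_of_irreducible hirr)
  have hcop : ∀ f : ℝ³[X], ¬ q ∣ f → ∀ S ⊆ G, (∀ l ∈ S, VanishesOn q l) →
      (∀ l ∈ S, VanishesOn f l) → S.card ≤ q.totalDegree * f.totalDegree := by
    intro f hf S hSG hSq hSf
    have hf0 : f ≠ 0 := by
      rintro rfl
      exact hf (dvd_zero q)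
    refine card_common_lines_le hf0 ?_ (fun l hl => hG l (hSG hl)) hSq hSf
    exact (hirr.isRelPrime_iff_not_dvd).2 hf
  by_cases hall : ∀ a b, q ∣ flatPoly p a b
  · obtain ⟨s, hs⟩ := hqp
    obtain ⟨i, hi⟩ : ∃ i, ¬ q ∣ pderiv i p := by
      by_contra! h
      have hqs : ¬ q ∣ s := by
        rintro ⟨r, rfl⟩
        exact hsq ⟨r, by rw [hs, mul_assoc]⟩
      have hdq : ∀ i, pderiv i q = 0 := by
        intro i
        by_contra h0
        have h1 := h i
        rw [hs, Derivation.leibniz, smul_eq_mul, smul_eq_mul,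
          dvd_add_right (dvd_mul_right _ _)] at h1
        have h2 := (hirr.prime.dvd_or_dvd h1).resolve_left hqs
        exact (totalDegree_le_of_dvd_of_isDomain h2 h0).not_gt (totalDegree_pderiv_lt h0)
      have hqC : q.totalDegree = 0 := by
        rw [totalDegree_eq_zero_iff_eq_C]
        ext m
        rw [coeff_C]
        split_ifs with hm
        · rw [hm]
        · obtain ⟨j, hj⟩ := Finsupp.ne_iff.1 (Ne.symm hm)
          have h1 := congrArg (coeff (m - Finsupp.single j 1)) (hdq j)
          rw [coeff_pderiv, coeff_zero, tsub_add_cancel_of_le] at h1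
          · exact (mul_eq_zero.1 h1).resolve_right (by positivity)
          · rw [Finsupp.single_le_iff]
            exact Nat.one_le_iff_ne_zero.2 hj
      omega
    have hsplit : {l ∈ G | VanishesOn q l} ⊆
        {l ∈ G | VanishesOn q l ∧ VanishesOn (pderiv i p) l} ∪
          {l ∈ G | VanishesOn q l ∧ ¬ VanishesOn (pderiv i p) l} := by
      intro l hl
      simp only [Finset.mem_union, Finset.mem_filter] at hl ⊢
      tauto
    have h1 : {l ∈ G | VanishesOn q l ∧ VanishesOn (pderiv i p) l}.card ≤
        q.totalDegree * p.totalDegree := by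
      refine (hcop _ hi _ (Finset.filter_subset _ _) ?_ ?_).trans
        (Nat.mul_le_mul_left _ (totalDegree_pderiv_le p i))
      · exact fun l hl => (Finset.mem_filter.1 hl).2.1
      · exact fun l hl => (Finset.mem_filter.1 hl).2.2
    have h2 : {l ∈ G | VanishesOn q l ∧ ¬ VanishesOn (pderiv i p) l}.card ≤ N := by
      rcases Finset.eq_empty_or_nonempty
        {l ∈ G | VanishesOn q l ∧ ¬ VanishesOn (pderiv i p) l} with h0 | ⟨l, hl⟩
      · rw [h0, Finset.card_empty]
        exact Nat.zero_le N
      · obtain ⟨hlG, hlq, hlp⟩ := Finset.mem_filter.1 hl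
        unfold VanishesOn at hlp
        push Not at hlp
        obtain ⟨x, hxl, hx⟩ := hlp
        obtain ⟨W, hW, hWl⟩ := exists_plane_of_flat hirr hs hall (hlq x hxl)
          (fun h => hx (congrFun h i))
        refine (Finset.card_le_card ?_).trans (hplane W hW)
        intro l' hl'
        obtain ⟨h3, h4, -⟩ := Finset.mem_filter.1 hl'
        exact Finset.mem_filter.2 ⟨h3, hWl l' h4⟩
    have h3 := (Finset.card_le_card hsplit).trans (Finset.card_union_le _ _)
    nlinarith [Nat.zero_le (q.totalDegree * p.totalDegree), Nat.mul_le_mul_right N hdeg]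
  · push Not at hall
    obtain ⟨a, b, hab⟩ := hall
    refine (hcop _ hab _ (Finset.filter_subset _ _) (fun l hl => (Finset.mem_filter.1 hl).2)
      (fun l hl => hflat l (Finset.mem_filter.1 hl).1 a b)).trans (Nat.mul_le_mul_left _ ?_)
    have := totalDegree_flatPoly_le p a b
    omega

open Classical in
theorem card_lines_le {p : ℝ³[X]} (hp : p ≠ 0) (hsq : ∀ q, Irreducible q → ¬ q * q ∣ p)
    {G : Finset (Set E³)} (hG : ∀ l ∈ G, IsLine3 l)
    (hflat : ∀ l ∈ G, ∀ a b, VanishesOn (flatPoly p a b) l) {N : ℕ}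
    (hplane : ∀ W : AffineSubspace ℝ E³, Module.finrank ℝ W.direction = 2 →
      {l ∈ G | l ⊆ (W : Set E³)}.card ≤ N) (hvan : ∀ l ∈ G, VanishesOn p l) :
    G.card ≤ p.totalDegree * (4 * p.totalDegree + N) := by
  have key : ∀ r : ℝ³[X], r ≠ 0 → r ∣ p →
      {l ∈ G | VanishesOn r l}.card ≤ r.totalDegree * (4 * p.totalDegree + N) := by
    intro r
    induction r using WfDvdMonoid.induction_on_irreducible with
    | zero => exact fun h => absurd rfl h
    | unit u hu =>
      intro _ _
      rw [Finset.filter_false_of_mem, Finset.card_empty]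
      · exact Nat.zero_le _
      · intro l hl h
        obtain ⟨x, v, -, rfl⟩ := hG l hl
        exact (hu.map (eval x.ofLp)).ne_zero (h x ⟨0, by simp⟩)
    | mul a i ha hi ih =>
      intro h0 hdvd
      have h1 := ih ha ((dvd_mul_left _ _).trans hdvd)
      have h2 := card_lines_irreducible_le hi ((dvd_mul_right _ _).trans hdvd) (hsq i hi) hG
        hflat hplane
      have h3 : {l ∈ G | VanishesOn (i * a) l} ⊆
          {l ∈ G | VanishesOn i l} ∪ {l ∈ G | VanishesOn a l} := by
        intro l hl
        obtain ⟨h4, h5⟩ := Finset.mem_filter.1 hl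
        rw [VanishesOn.mul_iff (hG l h4)] at h5
        simp only [Finset.mem_union, Finset.mem_filter]
        tauto
      rw [totalDegree_mul_of_isDomain hi.ne_zero ha, add_mul]
      exact (Finset.card_le_card h3).trans ((Finset.card_union_le _ _).trans (add_le_add h2 h1))
  have h := key p hp dvd_rfl
  rwa [Finset.filter_true_of_mem hvan] at h

/-- A nonzero polynomial of least degree vanishing on a finite set. -/
theorem exists_squarefree_poly (P : Finset E³) {n : ℕ} (hP : 6 * P.card < (n + 1) ^ 3) :
    ∃ p : ℝ³[X], p ≠ 0 ∧ p.totalDegree ≤ n ∧ (∀ y ∈ P, eval y.ofLp p = 0) ∧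
      ∀ q, Irreducible q → ¬ q * q ∣ p := by
  let ev : restrictTotalDegree (Fin 3) ℝ n →ₗ[ℝ] (P → ℝ) :=
    LinearMap.pi fun y => (aeval y.1.ofLp : ℝ³[X] →ₐ[ℝ] ℝ).toLinearMap ∘ₗ
      (restrictTotalDegree (Fin 3) ℝ n).subtype
  have hdim : Module.finrank ℝ (P → ℝ) < Module.finrank ℝ (restrictTotalDegree (Fin 3) ℝ n) := by
    have h := finrank_restrictTotalDegree_three n
    rw [Module.finrank_fintype_fun_eq_card, Fintype.card_coe]
    nlinarith
  obtain ⟨p₀, hp₀, hne⟩ := Submodule.exists_mem_ne_zero_of_ne_bot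
    (LinearMap.ker_ne_bot_of_finrank_lt (f := ev) hdim)
  have hex : ∃ d, ∃ p : ℝ³[X], p ≠ 0 ∧ p.totalDegree = d ∧ ∀ y ∈ P, eval y.ofLp p = 0 := by
    refine ⟨_, p₀, fun h => hne (Subtype.ext h), rfl, fun y hy => ?_⟩
    have h := congrFun (LinearMap.mem_ker.1 hp₀) ⟨y, hy⟩
    simpa [ev, aeval_eq_eval] using h
  classical
  obtain ⟨p, hp0, hpd, hpP⟩ := Nat.find_spec hex
  refine ⟨p, hp0, ?_, hpP, ?_⟩
  · rw [hpd]
    refine (Nat.find_min' hex ⟨p₀, fun h => hne (Subtype.ext h), rfl, fun y hy => ?_⟩).trans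
      ((mem_restrictTotalDegree (Fin 3) (R := ℝ) _ _).1 p₀.2)
    have h := congrFun (LinearMap.mem_ker.1 hp₀) ⟨y, hy⟩
    simpa [ev, aeval_eq_eval] using h
  · rintro q hq ⟨r, hr⟩
    have hqr : q * r ≠ 0 := by
      intro h
      rw [mul_assoc, h, mul_zero] at hr
      exact hp0 hr
    have hdeg := totalDegree_ne_zero_of_irreducible hq
    have h1 := Nat.find_min' hex ⟨q * r, hqr, rfl, fun y hy => ?_⟩
    · rw [← hpd, hr, mul_assoc, totalDegree_mul_of_isDomain hq.ne_zero hqr] at h1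
      omega
    · have h2 := hpP y hy
      rw [hr, mul_assoc, map_mul, mul_eq_zero] at h2
      rcases h2 with h2 | h2
      · rw [map_mul, h2, zero_mul]
      · exact h2

open Classical in
/-- Finset form of Bourgain's conjecture in dimension three. -/
theorem cube_le_card {N : ℕ} (hN : 0 < N) {L : Finset (Set E³)} (hL : ∀ l ∈ L, IsLine3 l)
    (hcard : L.card = N ^ 2)
    (hplane : ∀ W : AffineSubspace ℝ E³, Module.finrank ℝ W.direction = 2 →
      {l ∈ L | l ⊆ (W : Set E³)}.card < N)
    {P : Finset E³} (hP : ∀ l ∈ L, N ≤ {y ∈ P | y ∈ l}.card) :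
    N ^ 3 ≤ 1296 * P.card := by
  by_contra! hlt
  obtain ⟨p, hp0, hpd, hpP, hsq⟩ := exists_squarefree_poly P (n := N / 6) (by
    have h : N ^ 3 ≤ (6 * (N / 6 + 1)) ^ 3 := Nat.pow_le_pow_left (by omega) 3
    rw [mul_pow] at h
    omega)
  set d := p.totalDegree with hd
  have hdN : 6 * d ≤ N := by omega
  have hvan : ∀ l ∈ L, VanishesOn p l := fun l hl =>
    vanishesOn_of_card_lt (hL l hl) (T := {y ∈ P | y ∈ l})
      (fun y hy => (Finset.mem_filter.1 hy).2) (fun y hy => hpP y (Finset.mem_filter.1 hy).1)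
      (lt_of_lt_of_le (by omega) (hP l hl))
  let rich : E³ → Prop := fun y => 2 < {l ∈ L | y ∈ l}.card
  let good : Set E³ → Prop := fun l => 3 * d < {y ∈ P | y ∈ l ∧ rich y}.card
  have hgood : {l ∈ L | good l}.card ≤ d * (4 * d + N) := by
    refine card_lines_le hp0 hsq (fun l hl => hL l (Finset.mem_filter.1 hl).1) ?_ ?_
      (fun l hl => hvan l (Finset.mem_filter.1 hl).1)
    · intro l hl a b
      obtain ⟨hlL, hlg⟩ := Finset.mem_filter.1 hl
      refine vanishesOn_of_card_lt (hL l hlL) (T := {y ∈ P | y ∈ l ∧ rich y})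
        (fun y hy => (Finset.mem_filter.1 hy).2.1) ?_
        ((totalDegree_flatPoly_le p a b).trans_lt hlg)
      intro y hy
      obtain ⟨l₁, l₂, l₃, h₁, h₂, h₃, h₁₂, h₁₃, h₂₃⟩ :=
        Finset.two_lt_card_iff.1 (Finset.mem_filter.1 hy).2.2
      rw [Finset.mem_filter] at h₁ h₂ h₃
      exact eval_flatPoly_eq_zero (hL _ h₁.1) (hL _ h₂.1) (hL _ h₃.1) h₁.2 h₂.2 h₃.2
        (hvan _ h₁.1) (hvan _ h₂.1) (hvan _ h₃.1) h₁₂ h₁₃ h₂₃ a b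
    · intro W hW
      exact (Finset.card_le_card
        (Finset.filter_subset_filter _ (Finset.filter_subset _ _))).trans (hplane W hW).le
  have hbad : {l ∈ L | ¬ good l}.card * (N - 3 * d) ≤ P.card * 2 := by
    refine Finset.card_mul_le_card_mul (fun l y => y ∈ l ∧ ¬ rich y) ?_ ?_
    · intro l hl
      obtain ⟨hlL, hlg⟩ := Finset.mem_filter.1 hl
      have h1 := Finset.card_filter_add_card_filter_not (s := {y ∈ P | y ∈ l}) rich
      rw [Finset.filter_filter, Finset.filter_filter] at h1
      have h2 := hP l hlL
      simp only [good, not_lt] at hlg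
      simp only [Finset.bipartiteAbove]
      omega
    · intro y _
      by_cases hy : rich y
      · simp [Finset.bipartiteBelow, hy]
      · refine (Finset.card_le_card ?_).trans (not_lt.1 hy)
        intro l hl
        simp only [Finset.bipartiteBelow, Finset.mem_filter] at hl ⊢
        exact ⟨hl.1.1, hl.2.1⟩
  have hsum := Finset.card_filter_add_card_filter_not (s := L) good
  set g := {l ∈ L | good l}.card
  set b := {l ∈ L | ¬ good l}.card
  have hb : b * N ≤ 4 * P.card := by
    have h : b * N ≤ b * (2 * (N - 3 * d)) := Nat.mul_le_mul_left b (by omega)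
    linarith
  have hb' : 324 * b < N ^ 2 := by
    refine lt_of_mul_lt_mul_right (a := N) ?_ (Nat.zero_le N)
    linarith [show N ^ 2 * N = N ^ 3 by ring]
  have hg : 36 * g ≤ 10 * N ^ 2 := by nlinarith
  rw [hcard] at hsum
  omega

end

/-- Bourgain's conjecture in `ℝ³` (theorem of Guth–Katz): if `N²` lines in `ℝ³` are
such that every plane contains fewer than `N` of them, and a finite set `P` has at
least `N` points on each line, then `|P| ≥ c·N³`. -/
theorem bourgain_conjecture_dim3 :
    ∃ c : ℝ, 0 < c ∧
      ∀ N : ℕ, 0 < N →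
        ∀ L : Set (Set (EuclideanSpace ℝ (Fin 3))),
          (∀ l ∈ L, IsLine3 l) →
          L.ncard = N ^ 2 →
          (∀ W : AffineSubspace ℝ (EuclideanSpace ℝ (Fin 3)),
            Module.finrank ℝ W.direction = 2 →
            {l ∈ L | l ⊆ (W : Set (EuclideanSpace ℝ (Fin 3)))}.ncard < N) →
          ∀ P : Set (EuclideanSpace ℝ (Fin 3)), P.Finite →
            (∀ l ∈ L, N ≤ (P ∩ l).ncard) →
            c * (N : ℝ) ^ 3 ≤ (P.ncard : ℝ) := by
  classical
  refine ⟨1 / 1296, by norm_num, ?_⟩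
  intro N hN L hL hcard hplane P hPfin hP
  have hLfin : L.Finite := Set.finite_of_ncard_pos (by rw [hcard]; positivity)
  lift L to Finset (Set (EuclideanSpace ℝ (Fin 3))) using hLfin
  lift P to Finset (EuclideanSpace ℝ (Fin 3)) using hPfin
  rw [Set.ncard_coe_finset] at hcard ⊢
  have h : N ^ 3 ≤ 1296 * P.card := by
    refine cube_le_card hN hL hcard (fun W hW => ?_) (fun l hl => ?_)
    · rw [← Set.ncard_coe_finset, Finset.coe_filter]
      exact hplane W hW
    · rw [← Set.ncard_coe_finset, Finset.coe_filter]
      exact hP l hl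
  have h' : (N : ℝ) ^ 3 ≤ 1296 * P.card := by exact_mod_cast h
  linarith
end

section
/- Let n ≥ 1 and d ≥ 1 be integers and set M = C(n+d, n) − 1 (a binomial coefficient minus one). Let U_1, …, U_M be open subsets of ℝ^n, each of finite Lebesgue measure. Then there exists a nonzero polynomial Q in n real variables of total degree at most d such that for every i, the Lebesgue measure of {x ∈ U_i : Q(x) > 0} equals the Lebesgue measure of {x ∈ U_i : Q(x) < 0}. -/
open MeasureTheory

/-- A finite-dimensional commutative real algebra of odd dimension has a real point. -/
theorem nonempty_algHom_real_of_odd_finrank {A : Type*} [CommRing A] [Algebra ℝ A]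
    [Module.Finite ℝ A] (h : Odd (Module.finrank ℝ A)) : Nonempty (A →ₐ[ℝ] ℝ) := by
  by_contra hA
  have : IsArtinianRing A := IsArtinianRing.of_finite ℝ A
  have hfield (m : Ideal A) (hm : m.IsMaximal) : Even (Module.finrank ℝ (A ⧸ m)) := by
    let := Ideal.Quotient.field m
    rcases Real.nonempty_algEquiv_or (A ⧸ m) with ⟨⟨e⟩⟩ | ⟨⟨e⟩⟩
    · exact (hA ⟨(e : (A ⧸ m) →ₐ[ℝ] ℝ).comp (Ideal.Quotient.mkₐ ℝ m)⟩).elim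
    · rw [e.toLinearEquiv.finrank_eq, Complex.finrank_real_complex]
      exact even_two
  have key := IsNoetherianRing.induction_on_isQuotientEquivQuotientPrime A (M := A)
    inferInstance (motive := fun N _ _ _ =>
      ∀ [Module ℝ N] [IsScalarTower ℝ A N], Even (Module.finrank ℝ N))
    (fun N _ _ _ _ _ _ => by simp [Module.finrank_zero_of_subsingleton])
    (fun N _ _ _ p a _ _ => by
      rw [(a.restrictScalars ℝ).finrank_eq]
      exact hfield _ inferInstance)
    (fun N₁ _ _ _ N₂ _ _ _ N₃ _ _ _ f g hf hg hfg h₁ h₃ _ _ => by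
      let := Module.compHom N₁ (algebraMap ℝ A)
      let := Module.compHom N₃ (algebraMap ℝ A)
      have : IsScalarTower ℝ A N₁ := IsScalarTower.of_algebraMap_smul fun _ _ => rfl
      have : IsScalarTower ℝ A N₃ := IsScalarTower.of_algebraMap_smul fun _ _ => rfl
      have : Module.Finite ℝ N₂ := Module.Finite.trans A N₂
      have e := (g.restrictScalars ℝ).finrank_range_add_finrank_ker
      have hk : LinearMap.ker (g.restrictScalars ℝ) = LinearMap.range (f.restrictScalars ℝ) := by
        ext x
        simpa using hfg x
      rw [(LinearMap.range_eq_top (f := g.restrictScalars ℝ)).2 hg, finrank_top, hk,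
        LinearMap.finrank_range_of_inj (f := f.restrictScalars ℝ) hf] at e
      rw [← e]
      exact h₃.add h₁)
  exact Nat.not_even_iff_odd.2 h key

/-- For a surjective `f`, the maps `t • f + g` are surjective for all but finitely many `t`. -/
theorem finite_setOf_not_surjective_smul_add {K V W : Type*} [Field K] [AddCommGroup V]
    [Module K V] [AddCommGroup W] [Module K W] [FiniteDimensional K W] (f g : V →ₗ[K] W)
    (hf : Function.Surjective f) :
    {t : K | ¬ Function.Surjective (t • f + g)}.Finite := by
  obtain ⟨s, hs⟩ := f.exists_rightInverse_of_surjective (LinearMap.range_eq_top.2 hf)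
  refine (Module.End.finite_spectrum (-(g ∘ₗ s))).subset fun t ht hu => ht ?_
  have e : algebraMap K (Module.End K W) t - -(g ∘ₗ s) = (t • f + g) ∘ₗ s := by
    rw [LinearMap.add_comp, LinearMap.smul_comp, hs, sub_neg_eq_add]
    rfl
  have hu' := (Module.End.isUnit_iff _).1 (spectrum.mem_resolventSet_iff.1 hu)
  rw [e] at hu'
  exact Function.Surjective.of_comp (g := s) (by simpa using hu'.surjective)

namespace MvPolynomial

theorem mul_mem_restrictSupport {σ K : Type*} [Field K] {s t u : Set (σ →₀ ℕ)}
    (h : ∀ a ∈ s, ∀ b ∈ t, a + b ∈ u)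
    {p q : MvPolynomial σ K} (hp : p ∈ restrictSupport K s) (hq : q ∈ restrictSupport K t) :
    p * q ∈ restrictSupport K u := by
  classical
  intro m hm
  obtain ⟨a, ha, b, hb, rfl⟩ := Finset.mem_add.1 (support_mul p q hm)
  exact h a (hp ha) b (hq hb)

theorem mem_span_range_X_pow_iff {σ K : Type*} [Field K] {D : ℕ} {p : MvPolynomial σ K} :
    p ∈ Ideal.span (Set.range fun i : σ => (X i : MvPolynomial σ K) ^ D) ↔
      ∀ γ : σ →₀ ℕ, (∀ i, γ i < D) → coeff γ p = 0 := by
  have e : (Set.range fun i : σ => (X i : MvPolynomial σ K) ^ D) =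
      (fun s => monomial s (1 : K)) '' Set.range fun i => Finsupp.single i D := by
    rw [← Set.range_comp]
    simp [Function.comp_def, X_pow_eq_monomial]
  rw [e, mem_ideal_span_monomial_image]
  refine forall_congr' fun γ => ?_
  simp only [Set.exists_range_iff, Finsupp.single_le_iff, mem_support_iff]
  rw [not_imp_comm]
  simp

variable {σ K : Type*} [Fintype σ] [Field K]

/-- The linear endomorphism sending a monomial `x ^ γ` to `g ^ (γ / D) * x ^ (γ % D)`. -/
noncomputable def substPow (g : σ → MvPolynomial σ K) (D : ℕ) :
    MvPolynomial σ K →ₗ[K] MvPolynomial σ K :=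
  (basisMonomials σ K).constr K fun γ => ∏ i, g i ^ (γ i / D) * X i ^ (γ i % D)

theorem substPow_monomial (g : σ → MvPolynomial σ K) (D : ℕ) (γ : σ →₀ ℕ) :
    substPow g D (monomial γ 1) = ∏ i, g i ^ (γ i / D) * X i ^ (γ i % D) := by
  have := (basisMonomials σ K).constr_basis K (fun γ => ∏ i, g i ^ (γ i / D) * X i ^ (γ i % D)) γ
  rwa [coe_basisMonomials] at this

theorem substPow_X_pow_mul (g : σ → MvPolynomial σ K) {D : ℕ} (hD : 0 < D) (i : σ)
    (p : MvPolynomial σ K) : substPow g D (X i ^ D * p) = g i * substPow g D p := by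
  classical
  suffices h : substPow g D ∘ₗ LinearMap.mulLeft K (X i ^ D) =
      LinearMap.mulLeft K (g i) ∘ₗ substPow g D from LinearMap.congr_fun h p
  refine (basisMonomials σ K).ext fun γ => ?_
  simp only [coe_basisMonomials, LinearMap.comp_apply, LinearMap.mulLeft_apply,
    substPow_monomial]
  rw [X_pow_eq_monomial, monomial_mul, one_mul, substPow_monomial,
    ← Finset.mul_prod_erase _ _ (Finset.mem_univ i),
    ← Finset.mul_prod_erase Finset.univ (fun i => g i ^ (γ i / D) * X i ^ (γ i % D))
      (Finset.mem_univ i), ← mul_assoc]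
  congr 1
  · simp [Nat.add_div_left _ hD, pow_succ']
    ring
  · refine Finset.prod_congr rfl fun j hj => ?_
    simp [(Finset.ne_of_mem_erase hj).symm]

theorem substPow_of_reduced (g : σ → MvPolynomial σ K) {D : ℕ} {r : MvPolynomial σ K}
    (hr : r ∈ restrictSupport K {γ : σ →₀ ℕ | ∀ i, γ i < D}) : substPow g D r = r := by
  rw [restrictSupport_eq_span] at hr
  induction hr using Submodule.span_induction with
  | mem x h =>
    obtain ⟨γ, hγ, rfl⟩ := h
    beta_reduce
    rw [substPow_monomial, monomial_eq, Finsupp.prod_fintype _ _ (by simp)]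
    simp [Nat.div_eq_of_lt (hγ _), Nat.mod_eq_of_lt (hγ _)]
  | zero => simp
  | add x y _ _ hx hy => rw [map_add, hx, hy]
  | smul a x _ hx => rw [map_smul, hx]

theorem totalDegree_substPow_le {g : σ → MvPolynomial σ K} {D : ℕ}
    (hg : ∀ i, (g i).totalDegree ≤ D) {k : ℕ} {p : MvPolynomial σ K}
    (hp : p ∈ restrictTotalDegree σ K k) :
    substPow g D p ∈ restrictTotalDegree σ K k := by
  rw [restrictTotalDegree, restrictSupport_eq_span] at hp
  induction hp using Submodule.span_induction with
  | mem x h =>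
    obtain ⟨γ, hγ, rfl⟩ := h
    rw [mem_restrictTotalDegree, substPow_monomial]
    refine (totalDegree_finsetProd _ _).trans (le_trans (Finset.sum_le_sum fun i _ => ?_)
      ((Finsupp.sum_fintype γ (fun _ e => e) (by simp)).symm.le.trans hγ))
    calc _ ≤ (γ i / D) * D + γ i % D := by
          refine (totalDegree_mul _ _).trans (add_le_add ((totalDegree_pow _ _).trans
            (Nat.mul_le_mul_left _ (hg i))) ?_)
          simp [totalDegree_X_pow]
      _ = γ i := Nat.div_add_mod' _ _
  | zero => simp
  | add x y _ _ hx hy => rw [map_add]; exact add_mem hx hy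
  | smul a x _ hx => rw [map_smul]; exact Submodule.smul_mem _ _ hx

/-- Division with remainder by `g` in degree at most `k`: the map `(r, h) ↦ r + ∑ i, g i * h i`
on reduced polynomials `r` of degree at most `k` and polynomials `h i` of degree at most
`k - D`. -/
noncomputable def divisionMap (g : σ → MvPolynomial σ K) (D k : ℕ) :
    restrictSupport K {γ : σ →₀ ℕ | γ.degree ≤ k ∧ ∀ i, γ i < D} ×
      (σ → restrictSupport K {γ : σ →₀ ℕ | γ.degree + D ≤ k}) →ₗ[K] MvPolynomial σ K :=
  (Submodule.subtype _).coprod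
    (∑ i, LinearMap.mulLeft K (g i) ∘ₗ Submodule.subtype _ ∘ₗ LinearMap.proj i)

theorem divisionMap_apply (g : σ → MvPolynomial σ K) (D k : ℕ) (x) :
    divisionMap g D k x = x.1 + ∑ i, g i * (x.2 i : MvPolynomial σ K) := by
  simp [divisionMap]

theorem restrictTotalDegree_eq_restrictSupport (k : ℕ) :
    restrictTotalDegree σ K k = restrictSupport K {γ : σ →₀ ℕ | γ.degree ≤ k} := by
  simp [restrictTotalDegree, Finsupp.degree_eq_sum, Finsupp.sum_fintype]

theorem mem_range_divisionMap {g : σ → MvPolynomial σ K} {D k : ℕ} {p : MvPolynomial σ K} :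
    p ∈ LinearMap.range (divisionMap g D k) ↔
      ∃ r ∈ restrictSupport K {γ : σ →₀ ℕ | γ.degree ≤ k ∧ ∀ i, γ i < D},
        ∃ h : σ → MvPolynomial σ K,
          (∀ i, h i ∈ restrictSupport K {γ : σ →₀ ℕ | γ.degree + D ≤ k}) ∧
            p = r + ∑ i, g i * h i := by
  constructor
  · rintro ⟨⟨r, h⟩, rfl⟩
    exact ⟨r, r.2, fun i => h i, fun i => (h i).2, divisionMap_apply _ _ _ _⟩
  · rintro ⟨r, hr, h, hh, rfl⟩
    exact ⟨⟨⟨r, hr⟩, fun i => ⟨h i, hh i⟩⟩, divisionMap_apply _ _ _ _⟩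

theorem range_divisionMap_le {g : σ → MvPolynomial σ K} {D : ℕ}
    (hg : ∀ i, (g i).totalDegree ≤ D) (k : ℕ) :
    LinearMap.range (divisionMap g D k) ≤ restrictTotalDegree σ K k := by
  intro p hp
  obtain ⟨r, hr, h, hh, rfl⟩ := mem_range_divisionMap.1 hp
  rw [restrictTotalDegree_eq_restrictSupport]
  refine add_mem (restrictSupport_mono K (fun γ hγ => hγ.1) hr) (sum_mem fun i _ => ?_)
  have hgi := (mem_restrictTotalDegree _ _ _).2 (hg i)
  rw [restrictTotalDegree_eq_restrictSupport] at hgi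
  refine mul_mem_restrictSupport (fun a ha b hb => ?_) hgi (hh i)
  simp only [Set.mem_ofPred_eq, map_add] at *
  omega

theorem range_divisionMap_mono (g : σ → MvPolynomial σ K) (D : ℕ) {k l : ℕ} (hkl : k ≤ l) :
    LinearMap.range (divisionMap g D k) ≤ LinearMap.range (divisionMap g D l) := by
  intro p hp
  obtain ⟨r, hr, h, hh, rfl⟩ := mem_range_divisionMap.1 hp
  exact mem_range_divisionMap.2 ⟨r,
    restrictSupport_mono K (fun γ hγ => And.intro (hγ.1.trans hkl) hγ.2) hr, h, fun i => restrictSupport_mono K (fun γ hγ => le_trans hγ hkl) (hh i), rfl⟩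

/-- Division with remainder in degrees up to `card σ * (D - 1) + 1` gives it in all degrees. -/
theorem le_range_divisionMap {g : σ → MvPolynomial σ K} {D : ℕ}
    (h : ∀ k ≤ Fintype.card σ * (D - 1) + 1,
      restrictTotalDegree σ K k ≤ LinearMap.range (divisionMap g D k)) (k : ℕ) :
    restrictTotalDegree σ K k ≤ LinearMap.range (divisionMap g D k) := by
  classical
  induction k with
  | zero => exact h 0 (by omega)
  | succ k ih =>
    rcases le_or_gt (k + 1) (Fintype.card σ * (D - 1) + 1) with hk | hk
    · exact h _ hk
    rw [restrictTotalDegree_eq_restrictSupport, restrictSupport_eq_span, Submodule.span_le]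
    rintro _ ⟨γ, hγ, rfl⟩
    rcases eq_or_ne γ 0 with rfl | h0
    · refine range_divisionMap_mono g D (Nat.zero_le _) (h 0 (by omega) ?_)
      simp [mem_restrictTotalDegree]
    obtain ⟨j, hj⟩ := Finsupp.ne_iff.1 h0
    have hle : Finsupp.single j 1 ≤ γ := by
      simpa [Nat.one_le_iff_ne_zero] using hj
    obtain ⟨δ, rfl⟩ := exists_add_of_le hle
    have hδ : (monomial δ 1 : MvPolynomial σ K) ∈ restrictTotalDegree σ K k := by
      rw [restrictTotalDegree_eq_restrictSupport, restrictSupport_eq_span]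
      refine Submodule.subset_span ⟨δ, ?_, rfl⟩
      simp only [Set.mem_ofPred_eq, map_add, Finsupp.degree_single] at *
      omega
    obtain ⟨r, hr, q, hq, e⟩ := mem_range_divisionMap.1 (ih hδ)
    have hX : (X j : MvPolynomial σ K) ∈ restrictSupport K {γ : σ →₀ ℕ | γ.degree ≤ 1} := by
      rw [← restrictTotalDegree_eq_restrictSupport, mem_restrictTotalDegree, totalDegree_X]
    have e' : (monomial (Finsupp.single j 1 + δ) 1 : MvPolynomial σ K) =
        X j * r + (0 + ∑ i, g i * (X j * q i)) := by
      rw [← one_mul (1 : K), ← monomial_mul, e, mul_add, Finset.mul_sum, zero_add, X]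
      simp only [mul_left_comm]
    rw [SetLike.mem_coe]; beta_reduce; rw [e']
    refine add_mem (range_divisionMap_mono g D hk.le (h _ le_rfl ?_))
      (mem_range_divisionMap.2 ⟨0, zero_mem _, _, fun i => mul_mem_restrictSupport ?_ hX (hq i),
        rfl⟩)
    · rw [restrictTotalDegree_eq_restrictSupport]
      refine mul_mem_restrictSupport (fun a ha b hb => ?_) hX hr
      have : b.degree ≤ Fintype.card σ * (D - 1) := by
        rw [Finsupp.degree_eq_sum, ← smul_eq_mul]
        exact Finset.sum_le_card_nsmul _ _ _ fun i _ => Nat.le_sub_one_of_lt (hb.2 i)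
      simp only [Set.mem_ofPred_eq, map_add] at *
      omega
    · intro a ha b hb
      simp only [Set.mem_ofPred_eq, map_add] at *
      omega

theorem substPow_bijective {g : σ → MvPolynomial σ K} {D : ℕ} (hD : 0 < D)
    (hg : ∀ i, (g i).totalDegree ≤ D)
    (h : ∀ k, restrictTotalDegree σ K k ≤ LinearMap.range (divisionMap g D k)) :
    Function.Bijective (substPow g D) := by
  have hsurj (k : ℕ) : ∀ p ∈ restrictTotalDegree σ K k,
      ∃ q ∈ restrictTotalDegree σ K k, substPow g D q = p := by
    induction k using Nat.strong_induction_on with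
    | _ k ih =>
      intro p hp
      obtain ⟨r, hr, q, hq, rfl⟩ := mem_range_divisionMap.1 (h k hp)
      have hq' (i : σ) : ∃ q' ∈ restrictSupport K {γ : σ →₀ ℕ | γ.degree + D ≤ k},
          substPow g D q' = q i := by
        rcases lt_or_ge k D with hk | hk
        · refine ⟨0, zero_mem _, ?_⟩
          rw [map_zero, eq_comm, ← support_eq_empty, Finset.eq_empty_iff_forall_notMem]
          intro γ hγ
          have := hq i hγ
          simp only [Set.mem_ofPred_eq] at this
          omega
        · have e : {γ : σ →₀ ℕ | γ.degree + D ≤ k} = {γ | γ.degree ≤ k - D} := by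
            ext; simp only [Set.mem_ofPred_eq]; omega
          have := hq i
          rw [e, ← restrictTotalDegree_eq_restrictSupport] at this ⊢
          exact ih _ (by omega) _ this
      choose q' hq' hqq' using hq'
      refine ⟨r + ∑ i, X i ^ D * q' i, ?_, ?_⟩
      · refine range_divisionMap_le (g := fun i => X i ^ D) (D := D)
          (fun i => by simp [totalDegree_X_pow]) k (mem_range_divisionMap.2 ⟨r, hr, q', hq', rfl⟩)
      · rw [map_add, map_sum, substPow_of_reduced g (restrictSupport_mono K (fun _ h => h.2) hr)]
        simp [substPow_X_pow_mul g hD, hqq']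
  refine ⟨(injective_iff_map_eq_zero _).2 fun p hp => ?_, fun p => ?_⟩
  · set k := p.totalDegree
    let E : restrictTotalDegree σ K k →ₗ[K] restrictTotalDegree σ K k :=
      (substPow g D).restrict fun _ => totalDegree_substPow_le hg
    have hE : Function.Injective E := LinearMap.injective_iff_surjective.2 fun y => by
      obtain ⟨q, hq, e⟩ := hsurj k y y.2
      exact ⟨⟨q, hq⟩, Subtype.ext e⟩
    have hpk : p ∈ restrictTotalDegree σ K k := (mem_restrictTotalDegree _ _ _).2 le_rfl
    have := @hE ⟨p, hpk⟩ 0 (Subtype.ext (by simpa [E] using hp))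
    simpa using this
  · obtain ⟨q, -, e⟩ := hsurj _ p ((mem_restrictTotalDegree _ _ _).2 le_rfl)
    exact ⟨q, e⟩

/-- If `substPow g D` is bijective, then `D ^ card σ` is the dimension of the quotient by `g`. -/
theorem finrank_quotient_of_substPow_bijective {g : σ → MvPolynomial σ K} {D : ℕ} (hD : 0 < D)
    (h : Function.Bijective (substPow g D)) :
    Module.Finite K (MvPolynomial σ K ⧸ Ideal.span (Set.range g)) ∧
      Module.finrank K (MvPolynomial σ K ⧸ Ideal.span (Set.range g)) = D ^ Fintype.card σ := by
  classical
  let E := LinearEquiv.ofBijective _ h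
  let c : MvPolynomial σ K →ₗ[K] ((σ → Fin D) → K) :=
    LinearMap.pi fun β => lcoeff K (Finsupp.equivFunOnFinite.symm fun i => (β i : ℕ))
  have hc : Function.Surjective c := by
    intro v
    refine ⟨∑ β, monomial (Finsupp.equivFunOnFinite.symm fun i => (β i : ℕ)) (v β), ?_⟩
    ext β
    simp only [c, LinearMap.pi_apply, lcoeff_apply, coeff_sum, coeff_monomial]
    rw [Finset.sum_eq_single β]
    · simp
    · intro b _ hb
      rw [if_neg]
      intro h
      exact hb (_root_.funext fun i => Fin.ext (by simpa using DFunLike.congr_fun h i))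
    · simp
  have hcker (p : MvPolynomial σ K) :
      c p = 0 ↔ p ∈ Ideal.span (Set.range fun i : σ => (X i : MvPolynomial σ K) ^ D) := by
    rw [mem_span_range_X_pow_iff]
    refine ⟨fun h γ hγ => ?_, fun h => ?_⟩
    · have := congrFun h fun i => (⟨γ i, hγ i⟩ : Fin D)
      simp only [c, LinearMap.pi_apply, lcoeff_apply, Pi.zero_apply] at this
      convert this
      ext
      simp
    · ext β
      exact h _ fun i => by simp
  have hE (p : MvPolynomial σ K) : E p ∈ Ideal.span (Set.range g) ↔
      p ∈ Ideal.span (Set.range fun i : σ => (X i : MvPolynomial σ K) ^ D) := by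
    have hEX (i : σ) (p : MvPolynomial σ K) : E (X i ^ D * p) = g i * E p :=
      substPow_X_pow_mul g hD i p
    constructor
    · intro hp
      obtain ⟨a, ha⟩ := Ideal.mem_span_range_iff_exists_fun.1 hp
      have : p = ∑ i, E.symm (a i) * X i ^ D := E.injective <| by
        rw [← ha, map_sum]
        refine Finset.sum_congr rfl fun i _ => ?_
        rw [mul_comm _ (X i ^ D), hEX, E.apply_symm_apply, mul_comm]
      exact Ideal.mem_span_range_iff_exists_fun.2 ⟨_, this.symm⟩
    · intro hp
      obtain ⟨a, rfl⟩ := Ideal.mem_span_range_iff_exists_fun.1 hp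
      refine Ideal.mem_span_range_iff_exists_fun.2 ⟨fun i => E (a i), ?_⟩
      rw [map_sum]
      refine Finset.sum_congr rfl fun i _ => ?_
      rw [mul_comm (a i), hEX, mul_comm]
  let φ : MvPolynomial σ K →ₗ[K] ((σ → Fin D) → K) := c ∘ₗ E.symm.toLinearMap
  have hφ : Function.Surjective φ := hc.comp E.symm.surjective
  have hker : (Ideal.span (Set.range g)).restrictScalars K = LinearMap.ker φ := by
    ext p
    rw [Submodule.restrictScalars_mem, LinearMap.mem_ker, LinearMap.comp_apply, hcker, ← hE]
    simp
  let e : (MvPolynomial σ K ⧸ Ideal.span (Set.range g)) ≃ₗ[K] ((σ → Fin D) → K) :=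
    (Submodule.Quotient.restrictScalarsEquiv K _).symm ≪≫ₗ
      Submodule.quotEquivOfEq _ _ hker ≪≫ₗ φ.quotKerEquivOfSurjective hφ
  refine ⟨Module.Finite.equiv e.symm, ?_⟩
  rw [e.finrank_eq]
  simp

/-- Bezout-type statement: for all but finitely many `t`, the polynomials `t * x_i ^ D + f_i`
cut out a quotient of dimension `D ^ card σ`. -/
theorem finite_setOf_finrank_quotient_ne (f : σ → MvPolynomial σ K) {D : ℕ} (hD : 0 < D)
    (hf : ∀ i, (f i).totalDegree ≤ D) :
    {t : K | ¬ (Module.Finite K (MvPolynomial σ K ⧸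
        Ideal.span (Set.range fun i => C t * X i ^ D + f i)) ∧
      Module.finrank K (MvPolynomial σ K ⧸
        Ideal.span (Set.range fun i => C t * X i ^ D + f i)) = D ^ Fintype.card σ)}.Finite := by
  classical
  have hX (i : σ) : ((X i : MvPolynomial σ K) ^ D).totalDegree ≤ D := by
    rw [totalDegree_X_pow]
  let A (k : ℕ) := (divisionMap (fun i : σ => (X i : MvPolynomial σ K) ^ D) D k).codRestrict
    (restrictTotalDegree σ K k) fun x => range_divisionMap_le hX k ⟨x, rfl⟩
  let B (k : ℕ) := (divisionMap f D k).codRestrict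
    (restrictTotalDegree σ K k) fun x => range_divisionMap_le hf k ⟨x, rfl⟩
  have hA (k : ℕ) : Function.Surjective (A k) := by
    suffices h : restrictTotalDegree σ K k ≤
        LinearMap.range (divisionMap (fun i : σ => (X i : MvPolynomial σ K) ^ D) D k) by
      rintro ⟨p, hp⟩
      obtain ⟨x, hx⟩ := h hp
      exact ⟨x, Subtype.ext hx⟩
    rw [restrictTotalDegree_eq_restrictSupport, restrictSupport_eq_span, Submodule.span_le]
    rintro _ ⟨γ, hγ, rfl⟩
    rw [SetLike.mem_coe, mem_range_divisionMap]
    beta_reduce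
    simp only [Set.mem_ofPred_eq] at hγ
    by_cases h : ∀ i, γ i < D
    · refine ⟨monomial γ 1, ?_, 0, fun i => zero_mem _, by simp⟩
      rw [restrictSupport_eq_span]
      exact Submodule.subset_span ⟨γ, ⟨hγ, h⟩, rfl⟩
    · push Not at h
      obtain ⟨i, hi⟩ := h
      obtain ⟨δ, rfl⟩ := exists_add_of_le (Finsupp.single_le_iff.2 hi)
      refine ⟨0, zero_mem _, Pi.single i (monomial δ 1), fun j => ?_, ?_⟩
      · rcases eq_or_ne j i with rfl | hj
        · rw [Pi.single_eq_same, restrictSupport_eq_span]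
          refine Submodule.subset_span ⟨δ, ?_, rfl⟩
          simp only [map_add, Finsupp.degree_single, Set.mem_ofPred_eq] at *
          omega
        · rw [Pi.single_eq_of_ne hj]
          exact zero_mem _
      · rw [Finset.sum_eq_single i]
        · simp [X_pow_eq_monomial]
        · intro j _ hj
          rw [Pi.single_eq_of_ne hj, mul_zero]
        · simp
  refine ((Finset.range (Fintype.card σ * (D - 1) + 2)).finite_toSet.biUnion fun k _ =>
    finite_setOf_not_surjective_smul_add (A k) (B k) (hA k)).subset fun t ht => ?_
  by_contra hcon
  refine ht (finrank_quotient_of_substPow_bijective hD (substPow_bijective hD (fun i => ?_)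
    (le_range_divisionMap fun k hk p hp => ?_)))
  · refine (totalDegree_add _ _).trans (max_le ?_ (hf i))
    rw [← smul_eq_C_mul]
    exact (totalDegree_smul_le _ _).trans (hX i)
  · have hs : Function.Surjective (t • A k + B k) := by
      by_contra h
      exact hcon (Set.mem_biUnion (Finset.mem_coe.2 (Finset.mem_range.2 (by omega))) h)
    obtain ⟨x, hx⟩ := hs ⟨p, hp⟩
    have hx' : _ = p := congrArg Subtype.val hx
    refine ⟨((t + 1) • x.1, x.2), ?_⟩
    rw [← hx']
    simp only [A, B, divisionMap_apply, LinearMap.add_apply, LinearMap.smul_apply,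
      Submodule.coe_add, Submodule.coe_smul, LinearMap.codRestrict_apply, smul_add, add_smul,
      one_smul, smul_eq_C_mul, Finset.mul_sum, add_mul, Finset.sum_add_distrib, mul_assoc]
    ring

end MvPolynomial

namespace MvPolynomial

theorem exists_aeval_eq_zero_of_odd {σ : Type*} [Fintype σ] (f : σ → MvPolynomial σ ℝ) {D : ℕ}
    (hD : Odd D) (hf : ∀ i, (f i).totalDegree ≤ D) {ε : ℝ} (hε : 0 < ε) :
    ∃ t ∈ Set.Ioo 0 ε, ∃ a : σ → ℝ, ∀ i, t * a i ^ D + eval a (f i) = 0 := by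
  obtain ⟨t, ht, hft⟩ :=
    (Set.Ioo_infinite hε).exists_notMem_finite (finite_setOf_finrank_quotient_ne f hD.pos hf)
  simp only [Set.mem_ofPred_eq, not_not] at hft
  obtain ⟨hfin, hrank⟩ := hft
  obtain ⟨φ⟩ := nonempty_algHom_real_of_odd_finrank (hrank ▸ hD.pow)
  set I : Ideal (MvPolynomial σ ℝ) := Ideal.span (Set.range fun i => C t * X i ^ D + f i)
  let ψ : MvPolynomial σ ℝ →ₐ[ℝ] ℝ := φ.comp (Ideal.Quotient.mkₐ ℝ I)
  refine ⟨t, ht, fun i => ψ (X i), fun i => ?_⟩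
  have h : ψ (C t * X i ^ D + f i) = 0 := by
    have : Ideal.Quotient.mk I (C t * X i ^ D + f i) = 0 :=
      Ideal.Quotient.eq_zero_iff_mem.2 (Ideal.subset_span (Set.mem_range_self i))
    simp only [ψ, AlgHom.comp_apply, Ideal.Quotient.mkₐ_eq_mk, this, map_zero]
  have hψ (p : MvPolynomial σ ℝ) : ψ p = eval (fun i => ψ (X i)) p := by
    conv_lhs => rw [aeval_unique ψ]
    rw [← coe_aeval_eq_eval]
    rfl
  rw [hψ] at h
  simpa using h

theorem totalDegree_aeval_le {σ τ K : Type*} [Fintype σ] [CommSemiring K]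
    {g : σ → MvPolynomial τ K}
    (hg : ∀ i, (g i).totalDegree ≤ 1) (p : MvPolynomial σ K) :
    (aeval g p).totalDegree ≤ p.totalDegree := by
  rw [aeval_def, eval₂_eq']
  refine totalDegree_finsetSum_le fun d hd => (totalDegree_mul _ _).trans ?_
  rw [algebraMap_eq, totalDegree_C, zero_add]
  refine (totalDegree_finsetProd _ _).trans (le_trans (Finset.sum_le_sum fun i _ => ?_)
    ((Finsupp.sum_fintype d (fun _ e => e) (by simp)).symm.le.trans (le_totalDegree hd)))
  exact (totalDegree_pow _ _).trans (by simpa using Nat.mul_le_mul_left (d i) (hg i))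

theorem IsHomogeneous.eval_smul {σ K : Type*} [Fintype σ] [CommSemiring K] {p : MvPolynomial σ K}
    {n : ℕ} (hp : p.IsHomogeneous n) (c : K) (x : σ → K) :
    eval (c • x) p = c ^ n * eval x p := by
  rw [eval_eq', eval_eq', Finset.mul_sum]
  refine Finset.sum_congr rfl fun d hd => ?_
  have h := hp (mem_support_iff.1 hd)
  rw [Finsupp.weight_apply, Finsupp.sum_fintype _ _ (by simp)] at h
  simp only [Pi.one_apply, smul_eq_mul, mul_one] at h
  simp only [Pi.smul_apply, smul_eq_mul, mul_pow, Finset.prod_mul_distrib,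
    Finset.prod_pow_eq_pow_sum, h]
  ring

/-- Real forms of the same odd degree, one fewer than the number of variables, are simultaneously
small at some point of the unit sphere. -/
theorem exists_mem_sphere_abs_eval_le {M : ℕ} (F : Fin M → MvPolynomial (Fin (M + 1)) ℝ) {D : ℕ}
    (hD : Odd D) (hF : ∀ i, (F i).IsHomogeneous D) {ε : ℝ} (hε : 0 < ε) :
    ∃ y ∈ Metric.sphere (0 : EuclideanSpace ℝ (Fin (M + 1))) 1, ∀ i, |eval y (F i)| ≤ ε := by
  let g : Fin (M + 1) → MvPolynomial (Fin M) ℝ := Fin.cons 1 X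
  have hg (j) : (g j).totalDegree ≤ 1 := by
    cases j using Fin.cases <;> simp [g]
  obtain ⟨t, ht, a, ha⟩ := exists_aeval_eq_zero_of_odd (fun i => aeval g (F i)) hD
    (fun i => (totalDegree_aeval_le hg _).trans (hF i).totalDegree_le) hε
  let x : EuclideanSpace ℝ (Fin (M + 1)) := WithLp.toLp 2 (Fin.cons 1 a)
  have hx (p : MvPolynomial (Fin (M + 1)) ℝ) : eval a (aeval g p) = eval x p := by
    rw [← coe_aeval_eq_eval, ← coe_aeval_eq_eval]
    simp only [RingHom.coe_coe]
    rw [← AlgHom.comp_apply, comp_aeval]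
    congr 2
    ext j
    cases j using Fin.cases <;> simp [g, x]
  have hx0 : x ≠ 0 := fun h => by simpa [x] using congrArg (fun v => v.ofLp 0) h
  have hn : 0 < ‖x‖ := norm_pos_iff.2 hx0
  refine ⟨‖x‖⁻¹ • x, by simp [norm_smul, hn.ne'], fun i => ?_⟩
  have hi : eval x (F i) = -(t * x i.succ ^ D) := by
    have := ha i
    rw [hx] at this
    simp only [x, Fin.cons_succ]
    linarith
  rw [WithLp.ofLp_smul, (hF i).eval_smul, hi, mul_neg, abs_neg, mul_left_comm, ← mul_pow, abs_mul,
    abs_pow, abs_of_pos ht.1, abs_mul, abs_inv, abs_norm]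
  refine (mul_le_of_le_one_right ht.1.le (pow_le_one₀ (by positivity) ?_)).trans ht.2.le
  rw [inv_mul_le_iff₀ hn, mul_one]
  simpa using PiLp.norm_apply_le x i.succ

/-- On the unit sphere, the odd part of a polynomial agrees with a form of any large odd degree. -/
theorem exists_isHomogeneous_eval_eq_odd_part {σ : Type*} [Fintype σ] (p : MvPolynomial σ ℝ)
    {N : ℕ} (hN : p.totalDegree ≤ N) :
    ∃ q : MvPolynomial σ ℝ, q.IsHomogeneous (2 * N + 1) ∧
      ∀ x ∈ Metric.sphere (0 : EuclideanSpace ℝ σ) 1,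
        eval x q = (eval x p - eval (-x) p) / 2 := by
  refine ⟨∑ j ∈ Finset.range (N + 1),
    homogeneousComponent (2 * j + 1) p * (∑ i, X i ^ 2) ^ (N - j), ?_, fun x hx => ?_⟩
  · refine IsHomogeneous.sum _ _ _ fun j hj => ?_
    have h2 : (∑ i : σ, X i ^ 2 : MvPolynomial σ ℝ).IsHomogeneous 2 :=
      IsHomogeneous.sum _ _ _ fun i _ => isHomogeneous_X_pow i 2
    have e : 2 * N + 1 = 2 * j + 1 + 2 * (N - j) := by
      have := Finset.mem_range.1 hj
      omega
    rw [e]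
    exact (homogeneousComponent_isHomogeneous _ _).mul (h2.pow _)
  have hp : p = ∑ k ∈ Finset.range (2 * (N + 1)), homogeneousComponent k p := by
    conv_lhs => rw [← sum_homogeneousComponent p]
    refine Finset.sum_subset (Finset.range_mono (by omega)) fun k _ hk => ?_
    refine homogeneousComponent_eq_zero _ _ ?_
    simp only [Finset.mem_range] at hk
    omega
  have hsum (y : σ → ℝ) :
      eval y p = ∑ k ∈ Finset.range (2 * (N + 1)), eval y (homogeneousComponent k p) := by
    conv_lhs => rw [hp, map_sum]
  have hparity (a : ℕ → ℝ) (n : ℕ) : ∑ k ∈ Finset.range (2 * n), a k -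
      ∑ k ∈ Finset.range (2 * n), (-1) ^ k * a k = 2 * ∑ j ∈ Finset.range n, a (2 * j + 1) := by
    induction n with
    | zero => simp
    | succ n ih =>
      rw [mul_add_one, Finset.sum_range_succ, Finset.sum_range_succ, Finset.sum_range_succ,
        Finset.sum_range_succ, Finset.sum_range_succ, mul_add, ← ih, pow_succ, pow_mul]
      ring
  have hone : ∑ i, x i ^ 2 = 1 := by
    rw [← EuclideanSpace.real_norm_sq_eq, mem_sphere_zero_iff_norm.1 hx, one_pow]
  have hneg (k : ℕ) : eval (-x.ofLp) (homogeneousComponent k p) =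
      (-1) ^ k * eval x (homogeneousComponent k p) := by
    rw [← (homogeneousComponent_isHomogeneous k p).eval_smul, neg_one_smul]
  have := hparity (fun k => eval x (homogeneousComponent k p)) (N + 1)
  rw [WithLp.ofLp_neg, hsum, hsum (-x.ofLp)]
  simp only [hneg, this]
  simp [hone]

/-- Polynomials approximate continuous functions uniformly on the unit sphere. -/
theorem exists_forall_mem_sphere_abs_eval_sub_lt {σ : Type*} [Fintype σ]
    {f : EuclideanSpace ℝ σ → ℝ} (hf : ContinuousOn f (Metric.sphere 0 1)) {ε : ℝ} (hε : 0 < ε) :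
    ∃ p : MvPolynomial σ ℝ, ∀ x ∈ Metric.sphere (0 : EuclideanSpace ℝ σ) 1,
      |eval x p - f x| < ε := by
  let S := Metric.sphere (0 : EuclideanSpace ℝ σ) 1
  let A : MvPolynomial σ ℝ →ₐ[ℝ] C(S, ℝ) := aeval fun i => ⟨fun x => x.1 i, by fun_prop⟩
  have hA (p : MvPolynomial σ ℝ) (x : S) : A p x = eval x.1 p := by
    induction p using MvPolynomial.induction_on with
    | C a => simp [A]
    | add p q hp hq => simp [hp, hq]
    | mul_X p i hp => simp [hp, A]
  have hsep : A.range.SeparatesPoints := by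
    intro x y hxy
    obtain ⟨i, hi⟩ : ∃ i, x.1 i ≠ y.1 i := by
      by_contra! h
      exact hxy (Subtype.ext (by ext i; exact h i))
    exact ⟨A (X i), ⟨_, ⟨X i, rfl⟩, rfl⟩, by simpa [hA] using hi⟩
  obtain ⟨⟨_, p, rfl⟩, hp⟩ := ContinuousMap.exists_mem_subalgebra_near_continuousMap_of_separatesPoints
    A.range hsep ⟨S.domRestrict f, hf.domRestrict⟩ ε hε
  refine ⟨p, fun x hx => ?_⟩
  have : |A p ⟨x, hx⟩ - f x| < ε := (ContinuousMap.norm_coe_le_norm _ ⟨x, hx⟩).trans_lt hp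
  rwa [hA] at this

end MvPolynomial

open MvPolynomial in
/-- The **Borsuk-Ulam theorem** for odd maps. -/
theorem exists_mem_sphere_eq_zero_of_odd {M : ℕ}
    (f : EuclideanSpace ℝ (Fin (M + 1)) → Fin M → ℝ)
    (hf : ContinuousOn f (Metric.sphere 0 1))
    (hodd : ∀ x ∈ Metric.sphere (0 : EuclideanSpace ℝ (Fin (M + 1))) 1, f (-x) = -f x) :
    ∃ x ∈ Metric.sphere (0 : EuclideanSpace ℝ (Fin (M + 1))) 1, f x = 0 := by
  obtain ⟨z, hz, hmin⟩ := (isCompact_sphere (0 : EuclideanSpace ℝ (Fin (M + 1))) 1).exists_isMinOn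
    (NormedSpace.sphere_nonempty.2 zero_le_one) hf.norm
  refine ⟨z, hz, ?_⟩
  by_contra h0
  have hpos : 0 < ‖f z‖ := norm_pos_iff.2 h0
  have hε : 0 < ‖f z‖ / 3 := by positivity
  choose p hp using fun i =>
    exists_forall_mem_sphere_abs_eval_sub_lt ((continuousOn_pi.1 hf) i) hε
  have hN (i : Fin M) : (p i).totalDegree ≤ ∑ i, (p i).totalDegree :=
    Finset.single_le_sum (f := fun i => (p i).totalDegree) (fun _ _ => Nat.zero_le _)
      (Finset.mem_univ i)
  choose q hq hqp using fun i => exists_isHomogeneous_eval_eq_odd_part (p i) (hN i)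
  obtain ⟨y, hy, hqy⟩ := exists_mem_sphere_abs_eval_le q (odd_two_mul_add_one _) hq hε
  have hlt : ‖f y‖ < ‖f z‖ := (pi_norm_lt_iff hpos).2 fun i => by
    have h1 := abs_lt.1 (hp i y hy)
    have h2 := abs_lt.1 (hp i (-y) (by simpa using hy))
    have h3 := abs_le.1 (hqy i)
    have h4 := hqp i y hy
    rw [hodd y hy, Pi.neg_apply] at h2
    rw [Real.norm_eq_abs, abs_lt]
    constructor <;> linarith
  exact (hmin hy).not_gt hlt

/-- The zero set of a nonzero real polynomial is a null set. -/
theorem MvPolynomial.volume_setOf_eval_eq_zero {n : ℕ} {P : MvPolynomial (Fin n) ℝ} (hP : P ≠ 0) :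
    volume {x : Fin n → ℝ | eval x P = 0} = 0 := by
  induction n with
  | zero =>
    rw [P.eq_C_of_isEmpty] at hP ⊢
    have h0 : coeff 0 P ≠ 0 := by simpa using hP
    simp [h0]
  | succ n ih =>
    let q := finSuccEquiv ℝ n P
    have hq : q ≠ 0 := by simpa [q] using hP
    have hmeas : MeasurableSet {z : ℝ × (Fin n → ℝ) | eval (Fin.cons z.1 z.2) P = 0} := by
      refine (isClosed_eq ((continuous_eval P).comp (continuous_pi fun j => ?_))
        continuous_const).measurableSet
      cases j using Fin.cases
      · simpa using continuous_fst
      · simp only [Fin.cons_succ]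
        fun_prop
    have hpre : {x : Fin (n + 1) → ℝ | eval x P = 0} =
        MeasurableEquiv.piFinSuccAbove (fun _ => ℝ) 0 ⁻¹'
          {z : ℝ × (Fin n → ℝ) | eval (Fin.cons z.1 z.2) P = 0} := by
      ext x
      simp [MeasurableEquiv.piFinSuccAbove]
    rw [hpre, (volume_preserving_piFinSuccAbove (fun _ => ℝ) 0).measure_preimage
      hmeas.nullMeasurableSet, Measure.volume_eq_prod, Measure.measure_prod_null hmeas]
    have hfin : {y : ℝ | q.eval (C y) = 0}.Finite :=
      Set.Finite.preimage (f := C) (C_injective _ _).injOn (Polynomial.finite_setOfPred_isRoot hq)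
    have hae : ∀ᵐ y : ℝ, q.eval (C y) ≠ 0 := by
      rw [ae_iff]
      simpa using hfin.measure_zero volume
    filter_upwards [hae] with y hy
    refine (congrArg volume ?_).trans (ih hy)
    ext s
    have := Polynomial.eval₂_at_apply (p := q) (eval s) (C y)
    rw [eval_C, ← Polynomial.eval_map] at this
    simp only [Set.preimage_ofPred_eq, Set.mem_ofPred_eq, eval_eq_eval_mv_eval']
    rw [← this]

/-- If `q c₀` vanishes almost nowhere, the measure of `{q c > 0}` is continuous at `c₀`. -/
theorem continuousAt_measureReal_setOf_pos {X α : Type*} [TopologicalSpace X]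
    [FirstCountableTopology X] [MeasurableSpace α] {μ : Measure α} [IsFiniteMeasure μ]
    {q : X → α → ℝ} (hq : ∀ c, Measurable (q c)) (hcont : ∀ x, Continuous fun c => q c x) {c₀ : X}
    (h0 : ∀ᵐ x ∂μ, q c₀ x ≠ 0) : ContinuousAt (fun c => μ.real {x | 0 < q c x}) c₀ := by
  have hmeas (c : X) : MeasurableSet {x | 0 < q c x} := measurableSet_lt measurable_const (hq c)
  simp only [← integral_indicator_one (hmeas _)]
  refine continuousAt_of_dominated (bound := fun _ => 1)
    (.of_forall fun c => ((measurable_const.indicator (hmeas c))).aestronglyMeasurable)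
    (.of_forall fun c => .of_forall fun x => ?_) (integrable_const _) ?_
  · by_cases h : 0 < q c x <;> simp [Set.indicator, h]
  · filter_upwards [h0] with x hx
    rcases hx.lt_or_gt with h | h
    · refine (continuousAt_const (y := (0 : ℝ))).congr ?_
      filter_upwards [(hcont x).continuousAt.eventually_lt_const h] with c hc
      simp [Set.indicator, hc.le]
    · refine (continuousAt_const (y := (1 : ℝ))).congr ?_
      filter_upwards [(hcont x).continuousAt.eventually_const_lt h] with c hc
      simp [Set.indicator, hc]

/-- There are `(n + d).choose n` monomials of degree at most `d` in `n` variables. -/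
theorem exists_injective_finsupp_degree_le (n d : ℕ) :
    ∃ γ : Fin ((n + d).choose n) → (Fin n →₀ ℕ), Function.Injective γ ∧ ∀ j, (γ j).degree ≤ d := by
  let T := (Finset.univ : Finset (Fin (n + 1))).finsuppAntidiag d
  have hT : T.card = (n + d).choose n := by
    rw [Finset.card_finsuppAntidiag_nat_eq_choose, Finset.card_univ, Fintype.card_fin,
      Nat.choose_symm_add]
    congr 1
    omega
  have hsum (t : T) : t.1 0 + t.1.tail.degree = d := by
    have := (Finset.mem_finsuppAntidiag.1 t.2).1
    rw [Fin.sum_univ_succ] at this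
    rw [← this, Finsupp.degree_eq_sum]
    rfl
  refine ⟨fun j => (T.equivFinOfCardEq hT |>.symm j).1.tail, fun j k hjk => ?_, fun j => ?_⟩
  · refine (T.equivFinOfCardEq hT).symm.injective (Subtype.ext ?_)
    have h1 := hsum ((T.equivFinOfCardEq hT).symm j)
    have h2 := hsum ((T.equivFinOfCardEq hT).symm k)
    beta_reduce at hjk
    rw [← Finsupp.cons_tail ((T.equivFinOfCardEq hT).symm j).1,
      ← Finsupp.cons_tail ((T.equivFinOfCardEq hT).symm k).1, hjk]
    rw [hjk] at h1
    congr 1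
    omega
  · have := hsum ((T.equivFinOfCardEq hT).symm j)
    beta_reduce
    omega

/-- If there are `M + 1` monomials of degree at most `d` in `n` variables, then any `M` sets of
finite volume are bisected by a nonzero polynomial of degree at most `d`. -/
theorem exists_polynomial_bisecting {n d M : ℕ} (hM : M + 1 = (n + d).choose n)
    (U : Fin M → Set (EuclideanSpace ℝ (Fin n))) (hUvol : ∀ i, volume (U i) ≠ ⊤) :
    ∃ Q : MvPolynomial (Fin n) ℝ, Q ≠ 0 ∧ Q.totalDegree ≤ d ∧
      ∀ i,
        volume {x ∈ U i | 0 < MvPolynomial.eval (fun j => x j) Q} =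
        volume {x ∈ U i | MvPolynomial.eval (fun j => x j) Q < 0} := by
  obtain ⟨γ, hγ, hdeg⟩ := exists_injective_finsupp_degree_le n d
  let Q (c : EuclideanSpace ℝ (Fin (M + 1))) : MvPolynomial (Fin n) ℝ :=
    ∑ j, MvPolynomial.monomial (γ (Fin.cast hM j)) (c j)
  have hQ0 (c) (hc : c ≠ 0) : Q c ≠ 0 := by
    intro h
    refine hc (PiLp.ext fun j => ?_)
    have := congrArg (MvPolynomial.coeff (γ (Fin.cast hM j))) h
    simpa [Q, MvPolynomial.coeff_sum, MvPolynomial.coeff_monomial, hγ.eq_iff] using this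
  have hQneg (c) : Q (-c) = -Q c := by simp [Q]
  have hQcont (x : Fin n → ℝ) : Continuous fun c => MvPolynomial.eval x (Q c) := by
    simp only [Q, map_sum, MvPolynomial.eval_monomial]
    fun_prop
  have hmeas (c) : Measurable fun x : EuclideanSpace ℝ (Fin n) => MvPolynomial.eval x (Q c) :=
    ((MvPolynomial.continuous_eval (Q c)).comp (PiLp.continuous_ofLp 2 _)).measurable
  have hae (c) (hc : c ≠ 0) :
      ∀ᵐ x : EuclideanSpace ℝ (Fin n), MvPolynomial.eval x (Q c) ≠ 0 := by
    refine (PiLp.volume_preserving_ofLp (Fin n)).quasiMeasurePreserving.ae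
      (p := fun x => MvPolynomial.eval x (Q c) ≠ 0) ?_
    rw [ae_iff]
    simpa using MvPolynomial.volume_setOf_eval_eq_zero (hQ0 c hc)
  have hfin (i) : IsFiniteMeasure (volume.restrict (U i)) :=
    isFiniteMeasure_restrict.2 (hUvol i)
  let pos (i : Fin M) (c : EuclideanSpace ℝ (Fin (M + 1))) : ℝ :=
    (volume.restrict (U i)).real {x | 0 < MvPolynomial.eval x (Q c)}
  have hpos (i c) (hc : c ≠ 0) : ContinuousAt (pos i) c :=
    continuousAt_measureReal_setOf_pos hmeas (fun x => hQcont x) (ae_restrict_of_ae (hae c hc))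
  have hne (c : EuclideanSpace ℝ (Fin (M + 1))) (hc : c ∈ Metric.sphere 0 1) : c ≠ 0 :=
    Metric.ne_of_mem_sphere hc one_ne_zero
  obtain ⟨c, hc, h⟩ := exists_mem_sphere_eq_zero_of_odd (fun c i => pos i c - pos i (-c))
    (continuousOn_pi.2 fun i c hc => ((hpos i c (hne c hc)).sub
      (ContinuousAt.comp (hpos i (-c) (neg_ne_zero.2 (hne c hc)))
        continuousAt_neg)).continuousWithinAt)
    (fun c _ => by ext i; simp)
  refine ⟨Q c, hQ0 c (hne c hc), ?_, fun i => ?_⟩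
  · refine MvPolynomial.totalDegree_finsetSum_le fun j _ =>
      (MvPolynomial.totalDegree_monomial_le _ _).trans ?_
    rw [Finsupp.sum_fintype _ _ (by simp)]
    simpa [Finsupp.degree_eq_sum] using hdeg (Fin.cast hM j)
  · have hi : pos i c = pos i (-c) := sub_eq_zero.1 (congrFun h i)
    simp only [pos, hQneg, map_neg, Left.neg_pos_iff] at hi
    rw [measureReal_def, measureReal_def,
      ENNReal.toReal_eq_toReal_iff' (measure_ne_top _ _) (measure_ne_top _ _),
      Measure.restrict_apply (measurableSet_lt measurable_const (hmeas c)),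
      Measure.restrict_apply (measurableSet_lt (hmeas c) measurable_const),
      Set.inter_comm, Set.inter_comm _ (U i)] at hi
    exact hi

/-- Polynomial ham-sandwich theorem (Stone–Tukey): given `M = C(n+d, n) - 1` open sets
of finite volume in `ℝ^n`, there is a nonzero polynomial of degree at most `d` that
bisects each of them. -/
theorem polynomial_ham_sandwich
    (n d : ℕ) (hn : 1 ≤ n) (hd : 1 ≤ d)
    (U : Fin (Nat.choose (n + d) n - 1) → Set (EuclideanSpace ℝ (Fin n)))
    (hUopen : ∀ i, IsOpen (U i))
    (hUvol : ∀ i, volume (U i) ≠ ⊤) :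
    ∃ Q : MvPolynomial (Fin n) ℝ, Q ≠ 0 ∧ Q.totalDegree ≤ d ∧
      ∀ i,
        volume {x ∈ U i | 0 < MvPolynomial.eval (fun j => x j) Q} =
        volume {x ∈ U i | MvPolynomial.eval (fun j => x j) Q < 0} := by
  exact exists_polynomial_bisecting
    (Nat.sub_add_cancel (Nat.choose_pos (Nat.le_add_right n d))) U hUvol
end
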